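/- arXiv:0906.4617 — 9 statements merged into one kernel-verified Lean document; each statement's English description precedes it below -/
import Mathlib

section
/- Let (V, c) be a braided vector space over a field K and let β : V ⊗ V → V be a K-linear map satisfying (B1) c ∘ β₁ = β₂ ∘ c₁ ∘ c₂, (B2) c ∘ β₂ = β₁ ∘ c₂ ∘ c₁, and (A) β ∘ c = −β. Then β ∘ (β₁ + β₂) vanishes on Ē₂(V,c), i.e. β((β⊗id_V)(z) + (id_V⊗β)(z)) = 0 for every z ∈ V⊗V⊗V with c₁(z) = −z = c₂(z). -/
open TensorProduct Polynomial

noncomputable section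

variable (K V : Type*) [Field K] [AddCommGroup V] [Module K V]

/-- `c₁ := c ⊗ id` on `V ⊗ V ⊗ V` (transported along the associator). -/
def cOne (c : (V ⊗[K] V) →ₗ[K] (V ⊗[K] V)) :
    (V ⊗[K] (V ⊗[K] V)) →ₗ[K] (V ⊗[K] (V ⊗[K] V)) :=
  (TensorProduct.assoc K V V V).toLinearMap ∘ₗ LinearMap.rTensor V c ∘ₗ
    (TensorProduct.assoc K V V V).symm.toLinearMap

/-- `c₂ := id ⊗ c` on `V ⊗ V ⊗ V`. -/
def cTwo (c : (V ⊗[K] V) →ₗ[K] (V ⊗[K] V)) :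
    (V ⊗[K] (V ⊗[K] V)) →ₗ[K] (V ⊗[K] (V ⊗[K] V)) :=
  LinearMap.lTensor V c

/-- `β₁ := β ⊗ id : V ⊗ V ⊗ V → V ⊗ V`. -/
def betaOne (β : (V ⊗[K] V) →ₗ[K] V) :
    (V ⊗[K] (V ⊗[K] V)) →ₗ[K] (V ⊗[K] V) :=
  LinearMap.rTensor V β ∘ₗ (TensorProduct.assoc K V V V).symm.toLinearMap

/-- `β₂ := id ⊗ β : V ⊗ V ⊗ V → V ⊗ V`. -/
def betaTwo (β : (V ⊗[K] V) →ₗ[K] V) :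
    (V ⊗[K] (V ⊗[K] V)) →ₗ[K] (V ⊗[K] V) :=
  LinearMap.lTensor V β

/-- A lifted quadratic Lie algebra structure `(V, c, β)`:
the braiding `c` satisfies the quantum Yang–Baxter equation,
(B1) `c ∘ β₁ = β₂ ∘ c₁ ∘ c₂`, (B2) `c ∘ β₂ = β₁ ∘ c₂ ∘ c₁`,
(J) `β ∘ (β₁ − β₂)` vanishes on `Ē₂(V,c) = {z | c₁ z = −z = c₂ z}`, and
(A) `β ∘ c = −β`. -/
def IsLiftedQLie (c : (V ⊗[K] V) →ₗ[K] (V ⊗[K] V)) (β : (V ⊗[K] V) →ₗ[K] V) : Prop :=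
  (cOne K V c ∘ₗ cTwo K V c ∘ₗ cOne K V c = cTwo K V c ∘ₗ cOne K V c ∘ₗ cTwo K V c) ∧
  (c ∘ₗ betaOne K V β = betaTwo K V β ∘ₗ cOne K V c ∘ₗ cTwo K V c) ∧
  (c ∘ₗ betaTwo K V β = betaOne K V β ∘ₗ cTwo K V c ∘ₗ cOne K V c) ∧
  (∀ z : V ⊗[K] (V ⊗[K] V), cOne K V c z = -z → cTwo K V c z = -z →
    β (betaOne K V β z - betaTwo K V β z) = 0) ∧
  (β ∘ₗ c = -β)

/-- If `β` satisfies (B1), (B2) and (A) `β ∘ c = −β`, then `β ∘ (β₁ + β₂)` vanishes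
on `Ē₂(V,c)`. -/
theorem beta_comp_betaOne_add_betaTwo_eq_zero
    (c : (V ⊗[K] V) →ₗ[K] (V ⊗[K] V)) (β : (V ⊗[K] V) →ₗ[K] V)
    (hYB : cOne K V c ∘ₗ cTwo K V c ∘ₗ cOne K V c = cTwo K V c ∘ₗ cOne K V c ∘ₗ cTwo K V c)
    (hB1 : c ∘ₗ betaOne K V β = betaTwo K V β ∘ₗ cOne K V c ∘ₗ cTwo K V c)
    (hB2 : c ∘ₗ betaTwo K V β = betaOne K V β ∘ₗ cTwo K V c ∘ₗ cOne K V c)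
    (hA : β ∘ₗ c = -β) :
    ∀ z : V ⊗[K] (V ⊗[K] V), cOne K V c z = -z → cTwo K V c z = -z →
      β (betaOne K V β z + betaTwo K V β z) = 0 := by
  intro z h1 h2
  have e1 := LinearMap.congr_fun hB1 z
  have e2 := LinearMap.congr_fun hA (betaOne K V β z)
  simp only [LinearMap.comp_apply, LinearMap.neg_apply, h2, map_neg, h1, neg_neg] at e1 e2
  rw [e1] at e2
  rw [map_add, e2, add_neg_cancel]

end
end

section
/- Let K be a field with char K ≠ 2, (V, c) a braided vector space over K and β : V ⊗ V → V a K-linear map satisfying (B1) c ∘ β₁ = β₂ ∘ c₁ ∘ c₂, (B2) c ∘ β₂ = β₁ ∘ c₂ ∘ c₁, and (A) β ∘ c = −β. Then the following are equivalent: (i) β ∘ (β₁ − β₂) vanishes on Ē₂(V,c); (ii) β ∘ β₁ vanishes on Ē₂(V,c); (iii) β ∘ β₂ vanishes on Ē₂(V,c). -/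
open TensorProduct Polynomial

noncomputable section

variable (K V : Type*) [Field K] [AddCommGroup V] [Module K V]

/-- For `char K ≠ 2` and `β` satisfying (B1), (B2), (A), the following are equivalent:
(i) `β ∘ (β₁ − β₂)` vanishes on `Ē₂(V,c)`; (ii) `β ∘ β₁` vanishes on `Ē₂(V,c)`;
(iii) `β ∘ β₂` vanishes on `Ē₂(V,c)`. -/
theorem jacobi_iff_betaOne_iff_betaTwo
    (hchar : ringChar K ≠ 2)
    (c : (V ⊗[K] V) →ₗ[K] (V ⊗[K] V)) (β : (V ⊗[K] V) →ₗ[K] V)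
    (hYB : cOne K V c ∘ₗ cTwo K V c ∘ₗ cOne K V c = cTwo K V c ∘ₗ cOne K V c ∘ₗ cTwo K V c)
    (hB1 : c ∘ₗ betaOne K V β = betaTwo K V β ∘ₗ cOne K V c ∘ₗ cTwo K V c)
    (hB2 : c ∘ₗ betaTwo K V β = betaOne K V β ∘ₗ cTwo K V c ∘ₗ cOne K V c)
    (hA : β ∘ₗ c = -β) :
    ((∀ z : V ⊗[K] (V ⊗[K] V), cOne K V c z = -z → cTwo K V c z = -z →
        β (betaOne K V β z - betaTwo K V β z) = 0) ↔
      (∀ z : V ⊗[K] (V ⊗[K] V), cOne K V c z = -z → cTwo K V c z = -z →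
        β (betaOne K V β z) = 0)) ∧
    ((∀ z : V ⊗[K] (V ⊗[K] V), cOne K V c z = -z → cTwo K V c z = -z →
        β (betaOne K V β z - betaTwo K V β z) = 0) ↔
      (∀ z : V ⊗[K] (V ⊗[K] V), cOne K V c z = -z → cTwo K V c z = -z →
        β (betaTwo K V β z) = 0)) := by
  have h2 : (2 : K) ≠ 0 := Ring.two_ne_zero hchar
  have key : ∀ z : V ⊗[K] (V ⊗[K] V), cOne K V c z = -z → cTwo K V c z = -z →
      β (betaTwo K V β z) = - β (betaOne K V β z) := by
    intro z h₁ h₂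
    have e1 := LinearMap.congr_fun hB1 z
    have e2 := LinearMap.congr_fun hA (betaOne K V β z)
    simp only [LinearMap.comp_apply, LinearMap.neg_apply] at e1 e2
    rw [h₂, map_neg, h₁, neg_neg] at e1
    rw [← e1, e2]
  have key2 : ∀ z : V ⊗[K] (V ⊗[K] V), cOne K V c z = -z → cTwo K V c z = -z →
      (β (betaOne K V β z - betaTwo K V β z) = 0 ↔ β (betaOne K V β z) = 0) := by
    intro z h₁ h₂
    rw [map_sub, key z h₁ h₂, sub_neg_eq_add, ← two_smul K, smul_eq_zero]
    simp [h2]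
  refine ⟨forall_congr' fun z => forall_congr' fun h₁ => forall_congr' fun h₂ => key2 z h₁ h₂,
    forall_congr' fun z => forall_congr' fun h₁ => forall_congr' fun h₂ => ?_⟩
  rw [key2 z h₁ h₂, key z h₁ h₂, neg_eq_zero]

end
end

section
/- Let (V, c) be a braided vector space over a field K and let β : V ⊗ V → V be a K-linear map satisfying (B1) c ∘ β₁ = β₂ ∘ c₁ ∘ c₂ and (B2) c ∘ β₂ = β₁ ∘ c₂ ∘ c₁. Set L := Im β ⊆ V, with inclusion ι : L ↪ V. Then L is a categorical subspace of (V, c): c maps the image of the canonical map ι ⊗ id_V : L ⊗ V → V ⊗ V into the image of id_V ⊗ ι : V ⊗ L → V ⊗ V, and c maps the image of id_V ⊗ ι into the image of ι ⊗ id_V. -/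
open TensorProduct Polynomial

noncomputable section

variable (K V : Type*) [Field K] [AddCommGroup V] [Module K V]

/-- If `β` satisfies (B1) and (B2), then `L := Im β` is a categorical subspace of `(V, c)`:
`c(L ⊗ V) ⊆ V ⊗ L` and `c(V ⊗ L) ⊆ L ⊗ V`, where `L ⊗ V` (resp. `V ⊗ L`) denotes the image
in `V ⊗ V` of the map induced by the inclusion `L ↪ V`. -/
theorem range_beta_isCategorical
    (c : (V ⊗[K] V) →ₗ[K] (V ⊗[K] V)) (β : (V ⊗[K] V) →ₗ[K] V)
    (hYB : cOne K V c ∘ₗ cTwo K V c ∘ₗ cOne K V c = cTwo K V c ∘ₗ cOne K V c ∘ₗ cTwo K V c)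
    (hB1 : c ∘ₗ betaOne K V β = betaTwo K V β ∘ₗ cOne K V c ∘ₗ cTwo K V c)
    (hB2 : c ∘ₗ betaTwo K V β = betaOne K V β ∘ₗ cTwo K V c ∘ₗ cOne K V c) :
    Submodule.map c
        (LinearMap.range (LinearMap.rTensor V (LinearMap.range β).subtype)) ≤
      LinearMap.range (LinearMap.lTensor V (LinearMap.range β).subtype) ∧
    Submodule.map c
        (LinearMap.range (LinearMap.lTensor V (LinearMap.range β).subtype)) ≤
      LinearMap.range (LinearMap.rTensor V (LinearMap.range β).subtype) := by
  have hr : LinearMap.range (LinearMap.rTensor V (LinearMap.range β).subtype) =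
      LinearMap.range (betaOne K V β) := by
    have h1 : LinearMap.range (betaOne K V β) = LinearMap.range (LinearMap.rTensor V β) := by
      unfold betaOne
      exact LinearMap.range_comp_of_range_eq_top _ (LinearEquiv.range _)
    have h2 : LinearMap.rTensor V β =
        LinearMap.rTensor V (LinearMap.range β).subtype ∘ₗ
          LinearMap.rTensor V β.rangeRestrict := by
      rw [← LinearMap.rTensor_comp]
      rfl
    rw [h1, h2]
    exact (LinearMap.range_comp_of_range_eq_top _ (LinearMap.range_eq_top.2
      (LinearMap.rTensor_surjective V β.surjective_rangeRestrict))).symm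
  have hl : LinearMap.range (LinearMap.lTensor V (LinearMap.range β).subtype) =
      LinearMap.range (betaTwo K V β) := by
    have h2 : betaTwo K V β =
        LinearMap.lTensor V (LinearMap.range β).subtype ∘ₗ
          LinearMap.lTensor V β.rangeRestrict := by
      rw [← LinearMap.lTensor_comp]
      rfl
    rw [h2]
    exact (LinearMap.range_comp_of_range_eq_top _ (LinearMap.range_eq_top.2
      (LinearMap.lTensor_surjective V β.surjective_rangeRestrict))).symm
  rw [hr, hl, ← LinearMap.range_comp, ← LinearMap.range_comp, hB1, hB2]
  exact ⟨LinearMap.range_comp_le_range _ _, LinearMap.range_comp_le_range _ _⟩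

end
end

section
/- Let (V, c, β) be a lifted QLie algebra over a field K and set L := Im β with inclusion ι : L ↪ V. Then c maps the image of ι ⊗ ι : L ⊗ L → V ⊗ V into itself and β maps this image into L; moreover there exist K-linear maps c_L : L ⊗ L → L ⊗ L and β_L : L ⊗ L → L with (ι ⊗ ι) ∘ c_L = c ∘ (ι ⊗ ι) and ι ∘ β_L = β ∘ (ι ⊗ ι), and (L, c_L, β_L) is itself a lifted QLie algebra. -/
open TensorProduct Polynomial

noncomputable section

variable (K V : Type*) [Field K] [AddCommGroup V] [Module K V]

section helpers
variable {K V}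
variable {L : Type*} [AddCommGroup L] [Module K L]

theorem aux_cTwo (f : L →ₗ[K] V) (c : (V ⊗[K] V) →ₗ[K] (V ⊗[K] V))
    (d : (L ⊗[K] L) →ₗ[K] (L ⊗[K] L))
    (h : TensorProduct.map f f ∘ₗ d = c ∘ₗ TensorProduct.map f f) (z : L ⊗[K] (L ⊗[K] L)) :
    TensorProduct.map f (TensorProduct.map f f) (cTwo K L d z) =
      cTwo K V c (TensorProduct.map f (TensorProduct.map f f) z) := by
  have : TensorProduct.map f (TensorProduct.map f f) ∘ₗ cTwo K L d =
      cTwo K V c ∘ₗ TensorProduct.map f (TensorProduct.map f f) := by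
    simp only [cTwo, LinearMap.lTensor, ← TensorProduct.map_comp, h, LinearMap.comp_id,
      LinearMap.id_comp]
  exact LinearMap.congr_fun this z

theorem aux_assoc (f : L →ₗ[K] V) (z : (L ⊗[K] L) ⊗[K] L) :
    TensorProduct.map f (TensorProduct.map f f) (TensorProduct.assoc K L L L z) =
      TensorProduct.assoc K V V V (TensorProduct.map (TensorProduct.map f f) f z) := by
  exact LinearMap.congr_fun (TensorProduct.map_map_comp_assoc_eq f f f) z

theorem aux_assoc_symm (f : L →ₗ[K] V) (z : L ⊗[K] (L ⊗[K] L)) :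
    TensorProduct.map (TensorProduct.map f f) f ((TensorProduct.assoc K L L L).symm z) =
      (TensorProduct.assoc K V V V).symm (TensorProduct.map f (TensorProduct.map f f) z) := by
  rw [LinearEquiv.eq_symm_apply, ← aux_assoc, LinearEquiv.apply_symm_apply]

theorem aux_cOne (f : L →ₗ[K] V) (c : (V ⊗[K] V) →ₗ[K] (V ⊗[K] V))
    (d : (L ⊗[K] L) →ₗ[K] (L ⊗[K] L))
    (h : TensorProduct.map f f ∘ₗ d = c ∘ₗ TensorProduct.map f f) (z : L ⊗[K] (L ⊗[K] L)) :
    TensorProduct.map f (TensorProduct.map f f) (cOne K L d z) =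
      cOne K V c (TensorProduct.map f (TensorProduct.map f f) z) := by
  have : TensorProduct.map (TensorProduct.map f f) f ∘ₗ LinearMap.rTensor L d =
      LinearMap.rTensor V c ∘ₗ TensorProduct.map (TensorProduct.map f f) f := by
    simp only [LinearMap.rTensor, ← TensorProduct.map_comp, h, LinearMap.comp_id,
      LinearMap.id_comp]
  have h2 := LinearMap.congr_fun this ((TensorProduct.assoc K L L L).symm z)
  simp only [LinearMap.comp_apply] at h2
  simp only [cOne, LinearMap.comp_apply, LinearEquiv.coe_coe]
  rw [aux_assoc, h2, aux_assoc_symm]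

theorem aux_betaOne (f : L →ₗ[K] V) (β : (V ⊗[K] V) →ₗ[K] V) (b : (L ⊗[K] L) →ₗ[K] L)
    (h : f ∘ₗ b = β ∘ₗ TensorProduct.map f f) (z : L ⊗[K] (L ⊗[K] L)) :
    TensorProduct.map f f (betaOne K L b z) =
      betaOne K V β (TensorProduct.map f (TensorProduct.map f f) z) := by
  have : TensorProduct.map f f ∘ₗ LinearMap.rTensor L b =
      LinearMap.rTensor V β ∘ₗ TensorProduct.map (TensorProduct.map f f) f := by
    simp only [LinearMap.rTensor, ← TensorProduct.map_comp, h, LinearMap.comp_id,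
      LinearMap.id_comp]
  have h2 := LinearMap.congr_fun this ((TensorProduct.assoc K L L L).symm z)
  simp only [LinearMap.comp_apply] at h2
  simp only [betaOne, LinearMap.comp_apply, LinearEquiv.coe_coe]
  rw [h2, aux_assoc_symm]

theorem aux_betaTwo (f : L →ₗ[K] V) (β : (V ⊗[K] V) →ₗ[K] V) (b : (L ⊗[K] L) →ₗ[K] L)
    (h : f ∘ₗ b = β ∘ₗ TensorProduct.map f f) (z : L ⊗[K] (L ⊗[K] L)) :
    TensorProduct.map f f (betaTwo K L b z) =
      betaTwo K V β (TensorProduct.map f (TensorProduct.map f f) z) := by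
  have : TensorProduct.map f f ∘ₗ betaTwo K L b =
      betaTwo K V β ∘ₗ TensorProduct.map f (TensorProduct.map f f) := by
    simp only [betaTwo, LinearMap.lTensor, ← TensorProduct.map_comp, h, LinearMap.comp_id,
      LinearMap.id_comp]
  exact LinearMap.congr_fun this z

theorem aux_transfer (f : L →ₗ[K] V) (p : V →ₗ[K] L) (hp : p ∘ₗ f = LinearMap.id)
    (c : (V ⊗[K] V) →ₗ[K] (V ⊗[K] V)) (β : (V ⊗[K] V) →ₗ[K] V)
    (d : (L ⊗[K] L) →ₗ[K] (L ⊗[K] L)) (b : (L ⊗[K] L) →ₗ[K] L)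
    (hc : TensorProduct.map f f ∘ₗ d = c ∘ₗ TensorProduct.map f f)
    (hb : f ∘ₗ b = β ∘ₗ TensorProduct.map f f)
    (h : IsLiftedQLie K V c β) : IsLiftedQLie K L d b := by
  have hpp : TensorProduct.map p p ∘ₗ TensorProduct.map f f = LinearMap.id := by
    rw [← TensorProduct.map_comp, hp, TensorProduct.map_id]
  have hppp : TensorProduct.map p (TensorProduct.map p p) ∘ₗ
      TensorProduct.map f (TensorProduct.map f f) = LinearMap.id := by
    rw [← TensorProduct.map_comp, hp, hpp, TensorProduct.map_id]
  have i1 : Function.Injective f :=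
    Function.LeftInverse.injective (g := p) (fun x => LinearMap.congr_fun hp x)
  have i2 : Function.Injective (TensorProduct.map f f) :=
    Function.LeftInverse.injective (g := TensorProduct.map p p)
      (fun x => LinearMap.congr_fun hpp x)
  have i3 : Function.Injective (TensorProduct.map f (TensorProduct.map f f)) :=
    Function.LeftInverse.injective (g := TensorProduct.map p (TensorProduct.map p p))
      (fun x => LinearMap.congr_fun hppp x)
  have hc' : ∀ z, TensorProduct.map f f (d z) = c (TensorProduct.map f f z) :=
    fun z => LinearMap.congr_fun hc z
  have hb' : ∀ z, f (b z) = β (TensorProduct.map f f z) :=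
    fun z => LinearMap.congr_fun hb z
  have e1 := aux_cOne f c d hc
  have e2 := aux_cTwo f c d hc
  have e3 := aux_betaOne f β b hb
  have e4 := aux_betaTwo f β b hb
  obtain ⟨h1, h2, h3, h4, h5⟩ := h
  refine ⟨LinearMap.ext fun z => i3 ?_, LinearMap.ext fun z => i2 ?_,
    LinearMap.ext fun z => i2 ?_, fun z hz1 hz2 => i1 ?_, LinearMap.ext fun z => i1 ?_⟩
  · simp only [LinearMap.comp_apply, e1, e2]
    exact LinearMap.congr_fun h1 _
  · simp only [LinearMap.comp_apply, e1, e2, e3, e4, hc']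
    exact LinearMap.congr_fun h2 _
  · simp only [LinearMap.comp_apply, e1, e2, e3, e4, hc']
    exact LinearMap.congr_fun h3 _
  · rw [hb', map_sub, e3, e4, map_zero]
    apply h4
    · rw [← e1, hz1, map_neg]
    · rw [← e2, hz2, map_neg]
  · simp only [LinearMap.comp_apply, LinearMap.neg_apply, map_neg, hc', hb']
    exact LinearMap.congr_fun h5 _

/-- key invariance, with `e` a projection onto the range of `β`. -/
theorem aux_key (c : (V ⊗[K] V) →ₗ[K] (V ⊗[K] V)) (β : (V ⊗[K] V) →ₗ[K] V)
    (h : IsLiftedQLie K V c β) (e : V →ₗ[K] V) (he : e ∘ₗ β = β)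
    (x y : V ⊗[K] V) :
    TensorProduct.map e e (c (β x ⊗ₜ β y)) = c (β x ⊗ₜ β y) := by
  obtain ⟨-, h2, h3, -, -⟩ := h
  have a1 : LinearMap.lTensor V e (c (β x ⊗ₜ β y)) = c (β x ⊗ₜ β y) := by
    have : c (β x ⊗ₜ β y) = c (betaOne K V β (TensorProduct.assoc K V V V (x ⊗ₜ β y))) := by
      simp [betaOne]
    rw [this, ← LinearMap.comp_apply c, h2, LinearMap.comp_apply, betaTwo,
      ← LinearMap.comp_apply (LinearMap.lTensor V e), ← LinearMap.lTensor_comp, he]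
  have a2 : LinearMap.rTensor V e (c (β x ⊗ₜ β y)) = c (β x ⊗ₜ β y) := by
    have : c (β x ⊗ₜ β y) = c (betaTwo K V β (β x ⊗ₜ y)) := by
      simp [betaTwo]
    rw [this, ← LinearMap.comp_apply c, h3, LinearMap.comp_apply, betaOne, LinearMap.comp_apply,
      ← LinearMap.comp_apply (LinearMap.rTensor V e), ← LinearMap.rTensor_comp, he]
  rw [← LinearMap.rTensor_comp_lTensor, LinearMap.comp_apply, a1, a2]

end helpers

/-- If `(V, c, β)` is a lifted QLie algebra and `L := Im β`, then `c` preserves the image of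
`ι ⊗ ι : L ⊗ L → V ⊗ V`, `β` maps this image into `L`, and the restrictions `c_L`, `β_L`
make `(L, c_L, β_L)` a lifted QLie algebra. -/
theorem range_beta_liftedQLie_subalgebra
    (c : (V ⊗[K] V) →ₗ[K] (V ⊗[K] V)) (β : (V ⊗[K] V) →ₗ[K] V)
    (h : IsLiftedQLie K V c β) :
    Submodule.map c
        (LinearMap.range
          (TensorProduct.map (LinearMap.range β).subtype (LinearMap.range β).subtype)) ≤
      LinearMap.range
        (TensorProduct.map (LinearMap.range β).subtype (LinearMap.range β).subtype) ∧
    Submodule.map β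
        (LinearMap.range
          (TensorProduct.map (LinearMap.range β).subtype (LinearMap.range β).subtype)) ≤
      LinearMap.range β ∧
    ∃ (cL : ((LinearMap.range β) ⊗[K] (LinearMap.range β)) →ₗ[K]
        ((LinearMap.range β) ⊗[K] (LinearMap.range β)))
      (βL : ((LinearMap.range β) ⊗[K] (LinearMap.range β)) →ₗ[K] (LinearMap.range β)),
      TensorProduct.map (LinearMap.range β).subtype (LinearMap.range β).subtype ∘ₗ cL =
        c ∘ₗ TensorProduct.map (LinearMap.range β).subtype (LinearMap.range β).subtype ∧
      (LinearMap.range β).subtype ∘ₗ βL =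
        β ∘ₗ TensorProduct.map (LinearMap.range β).subtype (LinearMap.range β).subtype ∧
      IsLiftedQLie K (LinearMap.range β) cL βL := by
  obtain ⟨p, hp⟩ := LinearMap.exists_leftInverse_of_injective (LinearMap.range β).subtype
    (Submodule.ker_subtype _)
  have he : ((LinearMap.range β).subtype ∘ₗ p) ∘ₗ β = β := by
    ext1
    refine LinearMap.ext fun x => LinearMap.ext fun y => ?_
    have := LinearMap.congr_fun hp ⟨β (x ⊗ₜ y), LinearMap.mem_range_self _ _⟩
    exact congrArg Subtype.val this
  have hc : TensorProduct.map (LinearMap.range β).subtype (LinearMap.range β).subtype ∘ₗ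
      (TensorProduct.map p p ∘ₗ c ∘ₗ
        TensorProduct.map (LinearMap.range β).subtype (LinearMap.range β).subtype) =
      c ∘ₗ TensorProduct.map (LinearMap.range β).subtype (LinearMap.range β).subtype := by
    rw [← LinearMap.comp_assoc, ← TensorProduct.map_comp]
    apply TensorProduct.ext'
    rintro ⟨_, x, rfl⟩ ⟨_, y, rfl⟩
    exact aux_key c β h _ he x y
  have hb : (LinearMap.range β).subtype ∘ₗ (p ∘ₗ β ∘ₗ
        TensorProduct.map (LinearMap.range β).subtype (LinearMap.range β).subtype) =
      β ∘ₗ TensorProduct.map (LinearMap.range β).subtype (LinearMap.range β).subtype := by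
    rw [← LinearMap.comp_assoc, ← LinearMap.comp_assoc, he]
  refine ⟨?_, ?_, _, _, hc, hb, aux_transfer _ p hp c β _ _ hc hb h⟩
  · rw [← LinearMap.range_comp, ← hc]
    exact LinearMap.range_comp_le_range _ _
  · rw [← LinearMap.range_comp]
    exact LinearMap.range_comp_le_range _ _

end
end

section
/- Let (V, c) be a braided vector space over a field K and let β : V ⊗ V → V be a K-linear map satisfying (B1) c ∘ β₁ = β₂ ∘ c₁ ∘ c₂ and (B2) c ∘ β₂ = β₁ ∘ c₂ ∘ c₁. Then for every z ∈ Ē₂(V,c) one has (β₁ − β₂)(z) ∈ E₂(V,c), i.e. (c + Id_{V⊗V})((β₁ − β₂)(z)) = 0. -/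
open TensorProduct Polynomial

noncomputable section

variable (K V : Type*) [Field K] [AddCommGroup V] [Module K V]

/-- If `β` satisfies (B1) and (B2), then for every `z ∈ Ē₂(V,c)` one has
`(β₁ − β₂)(z) ∈ E₂(V,c) = ker (c + Id)`. -/
theorem betaOne_sub_betaTwo_mem_E2
    (c : (V ⊗[K] V) →ₗ[K] (V ⊗[K] V)) (β : (V ⊗[K] V) →ₗ[K] V)
    (hYB : cOne K V c ∘ₗ cTwo K V c ∘ₗ cOne K V c = cTwo K V c ∘ₗ cOne K V c ∘ₗ cTwo K V c)
    (hB1 : c ∘ₗ betaOne K V β = betaTwo K V β ∘ₗ cOne K V c ∘ₗ cTwo K V c)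
    (hB2 : c ∘ₗ betaTwo K V β = betaOne K V β ∘ₗ cTwo K V c ∘ₗ cOne K V c) :
    ∀ z : V ⊗[K] (V ⊗[K] V), cOne K V c z = -z → cTwo K V c z = -z →
      (c + (LinearMap.id : (V ⊗[K] V) →ₗ[K] (V ⊗[K] V)))
        (betaOne K V β z - betaTwo K V β z) = 0 := by
  intro z h1 h2
  have e1 := LinearMap.congr_fun hB1 z
  have e2 := LinearMap.congr_fun hB2 z
  simp only [LinearMap.comp_apply, h1, h2, map_neg, neg_neg] at e1 e2
  simp only [LinearMap.add_apply, LinearMap.id_apply, map_sub, e1, e2]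
  abel

end
end

section
/- Let K be a field with char K ≠ 2 and let (V, c, β) be a lifted QLie algebra over K such that Im β is one-dimensional. Then β vanishes on Im β ⊗ Im β, i.e. β(a ⊗ b) = 0 for all a, b ∈ Im β. -/
open TensorProduct Polynomial

noncomputable section

variable (K V : Type*) [Field K] [AddCommGroup V] [Module K V]

/-- If `char K ≠ 2` and `(V, c, β)` is a lifted QLie algebra with `Im β` one-dimensional,
then `β` vanishes on `Im β ⊗ Im β`. -/
theorem beta_vanishes_on_range_tmul_range
    (hchar : ringChar K ≠ 2)
    (c : (V ⊗[K] V) →ₗ[K] (V ⊗[K] V)) (β : (V ⊗[K] V) →ₗ[K] V)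
    (h : IsLiftedQLie K V c β)
    (hrange : Module.finrank K (LinearMap.range β) = 1) :
    ∀ a ∈ LinearMap.range β, ∀ b ∈ LinearMap.range β, β (a ⊗ₜ[K] b) = 0 := by
  obtain ⟨_, hB1, hB2, _, hA⟩ := h
  obtain ⟨⟨x, hxr⟩, hx0, hspan⟩ := finrank_eq_one_iff'.mp hrange
  have hx : x ≠ 0 := fun e => hx0 (Subtype.ext e)
  have hsp : ∀ a ∈ LinearMap.range β, ∃ k : K, k • x = a := fun a ha => by
    obtain ⟨k, hk⟩ := hspan ⟨a, ha⟩
    exact ⟨k, congrArg Subtype.val hk⟩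
  have key : β (x ⊗ₜ[K] x) = 0 := by
    have h2 : ∀ s : V ⊗[K] (V ⊗[K] V), ∃ y : V, betaTwo K V β s = y ⊗ₜ[K] x := by
      intro s
      induction s with
      | zero => exact ⟨0, by simp⟩
      | tmul u t =>
        obtain ⟨k, hk⟩ := hsp (β t) ⟨t, rfl⟩
        exact ⟨k • u, by simp [betaTwo, ← hk, TensorProduct.smul_tmul]⟩
      | add a b ha hb =>
        obtain ⟨y, hy⟩ := ha
        obtain ⟨z, hz⟩ := hb
        exact ⟨y + z, by rw [map_add, hy, hz, TensorProduct.add_tmul]⟩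
    have h1' : ∀ s : (V ⊗[K] V) ⊗[K] V, ∃ y : V, LinearMap.rTensor V β s = x ⊗ₜ[K] y := by
      intro s
      induction s with
      | zero => exact ⟨0, by simp⟩
      | tmul t u =>
        obtain ⟨k, hk⟩ := hsp (β t) ⟨t, rfl⟩
        exact ⟨k • u, by simp [← hk, TensorProduct.smul_tmul]⟩
      | add a b ha hb =>
        obtain ⟨y, hy⟩ := ha
        obtain ⟨z, hz⟩ := hb
        exact ⟨y + z, by rw [map_add, hy, hz, TensorProduct.tmul_add]⟩
    obtain ⟨t, ht⟩ := hxr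
    have e1 : ∃ y : V, c (x ⊗ₜ[K] x) = y ⊗ₜ[K] x := by
      have := LinearMap.congr_fun hB1 (TensorProduct.assoc K V V V (t ⊗ₜ[K] x))
      obtain ⟨y, hy⟩ := h2 ((cOne K V c ∘ₗ cTwo K V c) (TensorProduct.assoc K V V V (t ⊗ₜ[K] x)))
      refine ⟨y, ?_⟩
      rw [← hy]
      simpa [betaOne, ht] using this
    have e2 : ∃ z : V, c (x ⊗ₜ[K] x) = x ⊗ₜ[K] z := by
      have := LinearMap.congr_fun hB2 (x ⊗ₜ[K] t)
      obtain ⟨y, hy⟩ := h1' ((TensorProduct.assoc K V V V).symm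
        ((cTwo K V c ∘ₗ cOne K V c) (x ⊗ₜ[K] t)))
      refine ⟨y, ?_⟩
      rw [← hy]
      simpa [betaOne, betaTwo, ht] using this
    obtain ⟨y, hy⟩ := e1
    obtain ⟨z, hz⟩ := e2
    obtain ⟨g, hg⟩ := Module.Projective.exists_dual_ne_zero K hx
    have hyz : g x • y = g z • x := by
      have := congrArg (fun w => TensorProduct.rid K V (LinearMap.lTensor V g w)) (hy.symm.trans hz)
      simpa using this
    obtain ⟨l, hl⟩ : ∃ l : K, c (x ⊗ₜ[K] x) = l • (x ⊗ₜ[K] x) := by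
      refine ⟨(g x)⁻¹ * g z, ?_⟩
      rw [hy, TensorProduct.smul_tmul', mul_smul, ← hyz, inv_smul_smul₀ hg]
    obtain ⟨m, hm⟩ := hsp (β (x ⊗ₜ[K] x)) ⟨_, rfl⟩
    have hxx : x ⊗ₜ[K] x ≠ 0 := by
      intro e
      have := congrArg (fun w => TensorProduct.rid K V (LinearMap.lTensor V g w)) e
      simp [hg, hx] at this
    have hA' : l * m = -m := by
      have := LinearMap.congr_fun hA (x ⊗ₜ[K] x)
      simp only [LinearMap.comp_apply, LinearMap.neg_apply, hl, map_smul, ← hm] at this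
      rw [smul_smul, ← neg_smul] at this
      exact smul_left_injective K hx this
    have hB : m * l = l * (l * m) := by
      have := LinearMap.congr_fun hB1 (x ⊗ₜ[K] (x ⊗ₜ[K] x))
      simp only [LinearMap.comp_apply, betaOne, betaTwo, cOne, cTwo, LinearMap.lTensor_tmul,
        LinearMap.rTensor_tmul, LinearEquiv.coe_coe, TensorProduct.assoc_symm_tmul, hl, ← hm,
        TensorProduct.tmul_smul, map_smul, TensorProduct.assoc_tmul,
        ← TensorProduct.smul_tmul', smul_smul] at this
      have := smul_left_injective K hxx this
      linear_combination this
    have h20 : (2 : K) ≠ 0 := Ring.two_ne_zero hchar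
    have : 2 * m = 0 := by linear_combination (2 - l) * hA' - hB
    rw [← hm, (mul_eq_zero.mp this).resolve_left h20, zero_smul]
  intro a ha b hb
  obtain ⟨k, rfl⟩ := hsp a ha
  obtain ⟨k', rfl⟩ := hsp b hb
  simp [TensorProduct.tmul_smul, ← TensorProduct.smul_tmul', key]

end
end

section
/- Let K be a field with char K ≠ 2 and let (V, c, β) be a lifted QLie algebra over K with dim_K V = 2 and β ≠ 0. Assume that the minimal polynomial of c, regarded as an endomorphism of V ⊗ V, is of the form f = (X+1)·h with h ∈ K[X] and h(−1) ≠ 0. If dim_K Im β = 2, then dim_K Im(c + Id_{V⊗V}) = 2. -/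
open TensorProduct Polynomial

noncomputable section

variable (K V : Type*) [Field K] [AddCommGroup V] [Module K V]

set_option linter.all false
set_option linter.unusedSimpArgs false

namespace QL
variable {L : Type*} [Field L]

def dl (i j : Fin 2) : L := if i = j then 1 else 0

structure Hyp (F U : Fin 2 → Fin 2 → L) (B : Fin 2 → Fin 2 → Fin 2 → L)
    (H D H' C : Fin 2 → Fin 2 → Fin 2 → L) : Prop where
  bu : ∀ k, ∑ i, ∑ j, U i j * B i j k = 0
  b1 : ∀ i j k p q, B i j p * dl k q + dl i p * B j k q =
    (∑ r, B i j r * F r k) * U p q - F j k * (∑ m, F i m * H m p q) + F i j * D k p q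
  b2 : ∀ i j k p q, B i j p * dl k q + dl i p * B j k q =
    (∑ r, F i r * B j k r) * U p q - F i j * (∑ n, F n k * H' n p q) + F j k * C i p q
  yb : ∀ i j k p q r, F i j * U p q *
      ((∑ m, ∑ n, U m n * F n k * ∑ s, F m s * U s r) - ((∑ a, ∑ b, U a b * F a b) - 1) * dl k r)
    = F j k * U q r *
      ((∑ m, ∑ n, F i m * U m n * ∑ s, U p s * F s n) - ((∑ a, ∑ b, U a b * F a b) - 1) * dl i p)

def bv (B : Fin 2 → Fin 2 → Fin 2 → L) (x y : Fin 2 → L) (k : Fin 2) : L :=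
  ∑ i, ∑ j, x i * y j * B i j k
def ph (F : Fin 2 → Fin 2 → L) (x y : Fin 2 → L) : L := ∑ i, ∑ j, x i * y j * F i j

variable {F U : Fin 2 → Fin 2 → L} {B H D H' C : Fin 2 → Fin 2 → Fin 2 → L}

theorem b1v (h : Hyp F U B H D H' C) (x y z : Fin 2 → L) (p q : Fin 2) :
    bv B x y p * z q + x p * bv B y z q = ph F (bv B x y) z * U p q
      - ph F y z * (∑ m, (∑ i, x i * F i m) * H m p q) + ph F x y * (∑ k, z k * D k p q) := by
  have e := fun i j k => h.b1 i j k p q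
  have key : ∑ i, ∑ j, ∑ k, x i * y j * z k * (B i j p * dl k q + dl i p * B j k q) =
    ∑ i, ∑ j, ∑ k, x i * y j * z k * ((∑ r, B i j r * F r k) * U p q - F j k * (∑ m, F i m * H m p q) + F i j * D k p q) := by
    simp only [e]
  have hz : z q = ∑ k, z k * dl k q := by simp [dl]
  have hx : x p = ∑ k, x k * dl k p := by simp [dl]
  rw [hz, hx]
  simp only [bv, ph, Fin.sum_univ_two] at key ⊢
  linear_combination key

theorem b2v (h : Hyp F U B H D H' C) (x y z : Fin 2 → L) (p q : Fin 2) :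
    bv B x y p * z q + x p * bv B y z q = ph F x (bv B y z) * U p q
      - ph F x y * (∑ n, (∑ k, z k * F n k) * H' n p q) + ph F y z * (∑ k, x k * C k p q) := by
  have e := fun i j k => h.b2 i j k p q
  have key : ∑ i, ∑ j, ∑ k, x i * y j * z k * (B i j p * dl k q + dl i p * B j k q) =
    ∑ i, ∑ j, ∑ k, x i * y j * z k * ((∑ r, F i r * B j k r) * U p q - F i j * (∑ n, F n k * H' n p q) + F j k * C i p q) := by
    simp only [e]
  have hz : z q = ∑ k, z k * dl k q := by simp [dl]
  have hx : x p = ∑ k, x k * dl k p := by simp [dl]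
  rw [hz, hx]
  simp only [bv, ph, Fin.sum_univ_two] at key ⊢
  linear_combination key

/-- determinant zero case -/
theorem degen (h : Hyp F U B H D H' C) (hd : F 0 0 * F 1 1 - F 0 1 * F 1 0 = 0) : B = 0 := by
  obtain ⟨x, hx0, hx⟩ : ∃ x : Fin 2 → L, x ≠ 0 ∧ ∀ m, ∑ i, x i * F i m = 0 := by
    have : ∃ v, v ≠ 0 ∧ Matrix.vecMul v (Matrix.of F) = 0 := by
      rw [Matrix.exists_vecMul_eq_zero_iff, Matrix.det_fin_two]; simpa using hd
    obtain ⟨v, hv, hv'⟩ := this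
    exact ⟨v, hv, fun m => by simpa [Matrix.vecMul, dotProduct] using congrFun hv' m⟩
  obtain ⟨z, hz0, hz⟩ : ∃ x : Fin 2 → L, x ≠ 0 ∧ ∀ m, ∑ i, x i * F m i = 0 := by
    have : ∃ v, v ≠ 0 ∧ Matrix.mulVec (Matrix.of F) v = 0 := by
      rw [Matrix.exists_mulVec_eq_zero_iff, Matrix.det_fin_two]; simpa using hd
    obtain ⟨v, hv, hv'⟩ := this
    exact ⟨v, hv, fun m => by simpa [Matrix.mulVec, dotProduct, mul_comm] using congrFun hv' m⟩
  have pxl : ∀ y, ph F x y = 0 := by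
    intro y
    have h0 := hx 0
    have h1 := hx 1
    simp only [ph, Fin.sum_univ_two] at *
    linear_combination y 0 * h0 + y 1 * h1
  have pzl : ∀ y, ph F y z = 0 := by
    intro y
    have h0 := hz 0
    have h1 := hz 1
    simp only [ph, Fin.sum_univ_two] at *
    linear_combination y 0 * h0 + y 1 * h1
  obtain ⟨p, hp⟩ := Function.ne_iff.mp hx0
  obtain ⟨q, hq⟩ := Function.ne_iff.mp hz0
  simp only [Pi.zero_apply] at hp hq
  have k1 : ∀ y p q, bv B x y p * z q + x p * bv B y z q = 0 := by
    intro y p q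
    rw [b1v h, pzl, pzl, pxl]; ring
  have k2 : ∀ y i, bv B x y i = (- bv B y z q / z q) * x i := by
    intro y i; field_simp; linear_combination k1 y i q
  have k2' : ∀ y i, bv B y z i = (- bv B x y p / x p) * z i := by
    intro y i; field_simp; linear_combination k1 y p i
  have k3 : ∀ y w, ph F (bv B x y) w = 0 := by
    intro y w
    have := pxl w
    simp only [ph, Fin.sum_univ_two, k2] at this ⊢
    linear_combination (- bv B y z q / z q) * this
  have k3' : ∀ y w, ph F w (bv B y z) = 0 := by
    intro y w
    have := pzl w
    simp only [ph, Fin.sum_univ_two, k2'] at this ⊢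
    linear_combination (- bv B x y p / x p) * this
  have k4 : ∀ y w i, bv B y w i = (- bv B x y p / x p) * w i := by
    intro y w i
    have := b1v h x y w p i
    simp only [k3, pxl, hx] at this
    simp only [zero_mul, Finset.sum_const_zero, mul_zero] at this
    field_simp; linear_combination this
  have k5 : ∀ y w i, bv B w y i = (- bv B y z q / z q) * w i := by
    intro y w i
    have := b2v h w y z i q
    simp only [k3', pzl, hz] at this
    simp only [zero_mul, Finset.sum_const_zero, mul_zero] at this
    field_simp; linear_combination this
  have hB : ∀ i j k, B i j k = bv B (Pi.single i 1) (Pi.single j 1) k := by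
    intro i j k
    simp [bv, Pi.single_apply]
  have s0 : ∀ y, - bv B x y p / x p = 0 := by
    intro y
    -- y ∧ w ≠ 0 trick
    by_cases hy : y 0 = 0
    · have a := k4 y (Pi.single 0 1) 0
      rw [k5, hy] at a
      simpa using a.symm
    · have a0 := k4 y (Pi.single 1 1) 0
      have a1 := k4 y (Pi.single 1 1) 1
      rw [k5] at a0 a1
      generalize - bv B x y p / x p = s at *
      generalize - bv B (Pi.single 1 1) z q / z q = t at *
      simp at a0 a1
      rcases a0 with a0 | a0
      · rw [← a1, a0, zero_mul]
      · exact absurd a0 hy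
  funext i j k
  rw [hB, k4, s0]; simp

def sg (F : Fin 2 → Fin 2 → L) (y : Fin 2 → L) : Fin 2 → L :=
  ![F 1 0 * y 0 + F 1 1 * y 1, -(F 0 0 * y 0 + F 0 1 * y 1)]
def rh (F : Fin 2 → Fin 2 → L) (y : Fin 2 → L) : Fin 2 → L :=
  ![F 0 1 * y 0 + F 1 1 * y 1, -(F 0 0 * y 0 + F 1 0 * y 1)]

theorem ph_sg (y : Fin 2 → L) : ph F (sg F y) y = 0 := by
  simp [ph, sg, Fin.sum_univ_two]; ring
theorem ph_rh (y : Fin 2 → L) : ph F y (rh F y) = 0 := by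
  simp [ph, rh, Fin.sum_univ_two]; ring

theorem star1 (h : Hyp F U B H D H' C) (y : Fin 2 → L) (p q : Fin 2) :
    bv B (sg F y) y p * rh F y q + sg F y p * bv B y (rh F y) q
      = ph F (bv B (sg F y) y) (rh F y) * U p q := by
  rw [b1v h, ph_sg, ph_rh]; ring
theorem star2 (h : Hyp F U B H D H' C) (y : Fin 2 → L) (p q : Fin 2) :
    bv B (sg F y) y p * rh F y q + sg F y p * bv B y (rh F y) q
      = ph F (sg F y) (bv B y (rh F y)) * U p q := by
  rw [b2v h, ph_sg, ph_rh]; ring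

theorem fin_gamma (h : Hyp F U B H D H' C) (hd : F 0 0 * F 1 1 - F 0 1 * F 1 0 ≠ 0)
    (ht : (∑ a, ∑ b, U a b * F a b) ≠ 0)
    (hg : ∀ y k, bv B (sg F y) y k = 0) : B = 0 := by
  have key : ∀ k, (∀ i j, B i j k = 0) := by
    intro k
    have h0 := hg ![1,0] k
    have h1 := hg ![0,1] k
    have h2 := hg ![1,1] k
    have hu := h.bu k
    simp [bv, sg, Fin.sum_univ_two] at h0 h1 h2 hu ht
    have c00 : (F 0 0 * F 1 1 - F 0 1 * F 1 0) * B 0 0 k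
      = (B 0 0 k * F 1 1 - B 1 0 k * F 0 1) * F 0 0 := by linear_combination -F 0 1 * h0
    have c10 : (F 0 0 * F 1 1 - F 0 1 * F 1 0) * B 1 0 k
      = (B 0 0 k * F 1 1 - B 1 0 k * F 0 1) * F 1 0 := by linear_combination -F 1 1 * h0
    have c01 : (F 0 0 * F 1 1 - F 0 1 * F 1 0) * B 0 1 k
      = (B 0 0 k * F 1 1 - B 1 0 k * F 0 1) * F 0 1 := by
      linear_combination -F 0 1 * (h2 - h0 - h1) + F 0 0 * h1
    have c11 : (F 0 0 * F 1 1 - F 0 1 * F 1 0) * B 1 1 k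
      = (B 0 0 k * F 1 1 - B 1 0 k * F 0 1) * F 1 1 := by
      linear_combination -F 1 1 * (h2 - h0 - h1) + F 1 0 * h1
    have hk : (B 0 0 k * F 1 1 - B 1 0 k * F 0 1) = 0 := by
      refine (mul_eq_zero.mp ?_).resolve_right ht
      linear_combination (F 0 0 * F 1 1 - F 0 1 * F 1 0) * hu - U 0 0 * c00 - U 0 1 * c01
        - U 1 0 * c10 - U 1 1 * c11
    rw [hk] at c00 c01 c10 c11
    simp only [zero_mul, mul_eq_zero, hd, false_or] at c00 c01 c10 c11
    intro i j
    fin_cases i <;> fin_cases j <;> assumption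
  funext i j k
  exact key k i j

theorem bv_ext {x x' : Fin 2 → L} {y y' : Fin 2 → L} (B : Fin 2 → Fin 2 → Fin 2 → L) (k : Fin 2) (a b : L)
   (hx : ∀ i, x i = a * x' i) (hy : ∀ i, y i = b * y' i) : bv B x y k = a * b * bv B x' y' k := by
  simp only [bv, Fin.sum_univ_two, hx, hy]; ring

theorem lam_zero (h : Hyp F U B H D H' C) (h2 : (2 : L) ≠ 0)
    (hd : F 0 0 * F 1 1 - F 0 1 * F 1 0 ≠ 0)
    (ht : (∑ a, ∑ b, U a b * F a b) ≠ 0)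
    (hl : ∀ y, ph F (bv B (sg F y) y) (rh F y) = 0) : B = 0 := by
  apply fin_gamma h hd ht
  have st : ∀ y p q, bv B (sg F y) y p * rh F y q + sg F y p * bv B y (rh F y) q = 0 := by
    intro y p q; rw [star1 h, hl, zero_mul]
  have rs : ∀ y i, rh F (sg F y) i = -(F 0 0 * F 1 1 - F 0 1 * F 1 0) * y i := by
    intro y i
    fin_cases i <;> simp [rh, sg] <;> ring
  set d := F 0 0 * F 1 1 - F 0 1 * F 1 0 with hdd
  intro y
  by_cases hy : y = 0
  · intro k; simp [bv, hy]
  have e1 : bv B (sg F y) (rh F (sg F y)) = fun k => -d * bv B (sg F y) y k := by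
    funext k
    rw [bv_ext B k 1 (-d) (x' := sg F y) (y' := y) (by simp) (rs y)]; ring
  -- γ parallel to σ y
  have hs0 : sg F y ≠ 0 := by
    intro hs
    apply hy
    funext i
    have := rs y i
    rw [hs] at this
    have h0 : rh F (0 : Fin 2 → L) i = 0 := by fin_cases i <;> simp [rh]
    rw [h0] at this
    simpa [hd] using this.symm
  have hr0 : rh F y ≠ 0 := by
    intro hs
    have a0 := congrFun hs 0
    have a1 := congrFun hs 1
    simp [rh] at a0 a1
    apply hy
    funext i
    apply (mul_eq_zero.mp (_ : d * y i = 0)).resolve_left hd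
    fin_cases i
    · simp only [hdd, Fin.zero_eta]; linear_combination -F 1 0 * a0 - F 1 1 * a1
    · simp only [hdd, Fin.mk_one]; linear_combination F 0 0 * a0 + F 0 1 * a1
  obtain ⟨q, hq⟩ := Function.ne_iff.mp hr0
  obtain ⟨p, hp⟩ := Function.ne_iff.mp hs0
  simp only [Pi.zero_apply] at hp hq
  obtain ⟨s, hs⟩ : ∃ s, ∀ k, bv B (sg F y) y k = s * sg F y k :=
    ⟨- bv B y (rh F y) q / rh F y q, fun k => by field_simp; linear_combination st y k q⟩
  have hs' : ∀ k, bv B y (rh F y) k = -s * rh F y k := by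
    intro k
    have := st y p k
    rw [hs] at this
    apply mul_left_cancel₀ hp
    linear_combination this
  by_contra hne
  push Not at hne
  obtain ⟨k, hk⟩ := hne
  have hsn : s ≠ 0 := by rintro rfl; apply hk; rw [hs]; ring
  -- second: γ parallel to y
  have ss0 : sg F (sg F y) ≠ 0 := by
    intro hz
    have a0 := congrFun hz 0
    have a1 := congrFun hz 1
    have w0 : d * sg F y 0 = 0 := by
      simp only [sg, Pi.zero_apply, Matrix.cons_val_zero, Matrix.cons_val_one] at a0 a1 ⊢
      linear_combination -F 0 1 * a0 - F 1 1 * a1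
    have w1 : d * sg F y 1 = 0 := by
      simp only [sg, Pi.zero_apply, Matrix.cons_val_zero, Matrix.cons_val_one] at a0 a1 ⊢
      linear_combination F 0 0 * a0 + F 1 0 * a1
    apply hs0
    funext i
    fin_cases i
    · simpa [hd] using w0
    · simpa [hd] using w1
  obtain ⟨p', hp'⟩ := Function.ne_iff.mp ss0
  simp only [Pi.zero_apply] at hp'
  obtain ⟨s', hg⟩ : ∃ s', ∀ k, bv B (sg F y) y k = s' * y k := by
    refine ⟨- bv B (sg F (sg F y)) (sg F y) p' / sg F (sg F y) p', fun k => ?_⟩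
    have := st (sg F y) p' k
    rw [e1, rs] at this
    field_simp
    apply mul_left_cancel₀ hd
    linear_combination -this
  -- so σ y = μ y
  obtain ⟨μ, hμ⟩ : ∃ μ, ∀ k, sg F y k = μ * y k :=
    ⟨s' / s, fun k => by
      have := hs k
      rw [hg k] at this
      field_simp; linear_combination -this⟩
  have hμ0 : μ ≠ 0 := by rintro rfl; apply hp; rw [hμ]; ring
  have hr : ∀ k, rh F y k = -d / μ * y k := by
    intro k
    have := rs y k
    have e : rh F (sg F y) k = μ * rh F y k := by
      fin_cases k <;> simp [rh, hμ] <;> ring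
    rw [e] at this
    field_simp; linear_combination this
  have f1 := hs k
  have f2 := hs' k
  rw [bv_ext B k μ 1 (x' := y) (y' := y) hμ (by simp), hμ] at f1
  rw [bv_ext B k 1 (-d/μ) (x' := y) (y' := y) (by simp) hr, hr] at f2
  apply hk
  have f1' : bv B y y k = s * y k := by
    apply mul_left_cancel₀ hμ0; linear_combination f1
  have f2' : bv B y y k = - s * y k := by
    apply mul_left_cancel₀ (div_ne_zero (neg_ne_zero.mpr hd) hμ0); linear_combination f2
  have f3 : s * y k = 0 := by
    apply mul_left_cancel₀ h2; linear_combination f2' - f1'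
  rw [hs, hμ]; linear_combination μ * f3

theorem t_ne_two (h : Hyp F U B H D H' C) (h2 : (2 : L) ≠ 0)
    (hd : F 0 0 * F 1 1 - F 0 1 * F 1 0 ≠ 0)
    (ht : (∑ a, ∑ b, U a b * F a b) ≠ 0) (ht2 : (∑ a, ∑ b, U a b * F a b) ≠ 2) : B = 0 := by
  apply lam_zero h h2 hd ht
  intro y
  set l := ph F (bv B (sg F y) y) (rh F y) with hl
  have s1 := fun p q => star1 h y p q
  have s2 := fun p q => star2 h y p q
  rw [← hl] at s1
  have hl2 : ph F (sg F y) (bv B y (rh F y)) = l := by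
    have : ∃ p q, U p q ≠ 0 := by
      by_contra hc
      push Not at hc
      simp [hc] at ht
    obtain ⟨p, q, hpq⟩ := this
    apply mul_right_cancel₀ hpq
    rw [← s2, s1]
  have : (∑ a, ∑ b, U a b * F a b) * l = 2 * l := by
    have e : 2 * l = ph F (bv B (sg F y) y) (rh F y) + ph F (sg F y) (bv B y (rh F y)) := by
      rw [hl2, ← hl]; ring
    rw [e]
    have a := s1 0 0
    have b := s1 0 1
    have c := s1 1 0
    have d := s1 1 1
    generalize bv B (sg F y) y = G at *
    generalize bv B y (rh F y) = G' at *
    generalize sg F y = S at *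
    generalize rh F y = R at *
    simp only [ph, Fin.sum_univ_two] at a b c d ⊢
    linear_combination -F 0 0 * a - F 0 1 * b - F 1 0 * c - F 1 1 * d
  by_contra hc
  exact ht2 (mul_right_cancel₀ hc this)

theorem ab_one (h : Hyp F U B H D H' C)
    (hd : F 0 0 * F 1 1 - F 0 1 * F 1 0 ≠ 0)
    (ht : (∑ a, ∑ b, U a b * F a b) = 2) (h2 : (2 : L) ≠ 0) (k r : Fin 2) :
    (∑ m, ∑ n, U m n * F n k * ∑ s, F m s * U s r) = dl k r := by
  have : ∃ p q, U p q ≠ 0 := by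
    by_contra hc
    push Not at hc
    simp [hc] at ht
    exact h2 ht.symm
  obtain ⟨p, q, hpq⟩ := this
  have yb := fun i j => h.yb i j k p q r
  rw [ht] at yb
  set W := (∑ m, ∑ n, U m n * F n k * ∑ s, F m s * U s r) with hW
  have e0 := yb 0 0
  have e1 := yb 0 1
  have e2 := yb 1 0
  have e3 := yb 1 1
  generalize (∑ m, ∑ n, F 0 m * U m n * ∑ s, U p s * F s n) - (2 - 1) * dl 0 p = X at *
  generalize (∑ m, ∑ n, F 1 m * U m n * ∑ s, U p s * F s n) - (2 - 1) * dl 1 p = X' at *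
  have g0 : (F 0 0 * F 1 k - F 0 1 * F 0 k) * (U p q * (W - dl k r)) = 0 := by
    linear_combination F 1 k * e0 - F 0 k * e1
  have g1 : (F 1 0 * F 1 k - F 1 1 * F 0 k) * (U p q * (W - dl k r)) = 0 := by
    linear_combination F 1 k * e2 - F 0 k * e3
  generalize hX : U p q * (W - dl k r) = Y at *
  have r1 : F 1 k * Y = 0 := by
    apply mul_left_cancel₀ hd
    linear_combination F 1 1 * g0 - F 0 1 * g1
  have r0 : F 0 k * Y = 0 := by
    apply mul_left_cancel₀ hd
    linear_combination F 1 0 * g0 - F 0 0 * g1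
  have this : Y = 0 := by
    by_contra hY
    apply hd
    have r0' := (mul_eq_zero.mp r0).resolve_right hY
    have r1' := (mul_eq_zero.mp r1).resolve_right hY
    fin_cases k
    · simp only [Fin.zero_eta] at r0' r1'
      rw [r0', r1']; ring
    · simp only [Fin.mk_one] at r0' r1'
      rw [r0', r1']; ring
  rw [← hX] at this
  exact sub_eq_zero.mp ((mul_eq_zero.mp this).resolve_left hpq)

theorem lamQ (h : Hyp F U B H D H' C) (y : Fin 2 → L) :
    ph F (bv B (sg F y) y) (rh F y) *
      (∑ p, ∑ q, U p q * (∑ j, F p j * y j) * (∑ i, y i * F i q)) = 0 := by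
  have s1 := fun p q => star1 h y p q
  set l := ph F (bv B (sg F y) y) (rh F y) with hl
  have a := s1 0 0
  have b := s1 0 1
  have c := s1 1 0
  have d := s1 1 1
  generalize bv B (sg F y) y = G at *
  generalize bv B y (rh F y) = G' at *
  clear_value l
  simp only [sg, rh, Fin.sum_univ_two, Matrix.cons_val_zero, Matrix.cons_val_one] at a b c d ⊢
  linear_combination -(F 0 0 * y 0 + F 0 1 * y 1) * (y 0 * F 0 0 + y 1 * F 1 0) * a
    -(F 0 0 * y 0 + F 0 1 * y 1) * (y 0 * F 0 1 + y 1 * F 1 1) * b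
    -(F 1 0 * y 0 + F 1 1 * y 1) * (y 0 * F 0 0 + y 1 * F 1 0) * c
    -(F 1 0 * y 0 + F 1 1 * y 1) * (y 0 * F 0 1 + y 1 * F 1 1) * d

open Polynomial in
theorem forms [Infinite L] (a b c d e f g : L)
    (h : ∀ s : L, (a * s^3 + b * s^2 + c * s + d) * (e * s^2 + f * s + g) = 0) :
    (a = 0 ∧ b = 0 ∧ c = 0 ∧ d = 0) ∨ (e = 0 ∧ f = 0 ∧ g = 0) := by
  have : (Polynomial.C a * X^3 + Polynomial.C b * X^2 + Polynomial.C c * X + Polynomial.C d) *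
     (Polynomial.C e * X^2 + Polynomial.C f * X + Polynomial.C g) = 0 := by
    apply Polynomial.funext
    intro s
    simpa using h s
  rcases mul_eq_zero.mp this with h | h
  · left
    have h0 := congrArg (fun p => p.coeff 0) h
    have h1 := congrArg (fun p => p.coeff 1) h
    have h2 := congrArg (fun p => p.coeff 2) h
    have h3 := congrArg (fun p => p.coeff 3) h
    simp [coeff_X, coeff_C, coeff_X_pow] at h0 h1 h2 h3
    exact ⟨h3, h2, h1, h0⟩
  · right
    have h0 := congrArg (fun p => p.coeff 0) h
    have h1 := congrArg (fun p => p.coeff 1) h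
    have h2 := congrArg (fun p => p.coeff 2) h
    simp [coeff_X, coeff_C, coeff_X_pow] at h0 h1 h2
    exact ⟨h2, h1, h0⟩

theorem cubic_form (F : Fin 2 → Fin 2 → L) (B : Fin 2 → Fin 2 → Fin 2 → L) :
    ∃ a b c d : L, ∀ y, ph F (bv B (sg F y) y) (rh F y) =
      a * y 0 ^ 3 + b * y 0 ^ 2 * y 1 + c * y 0 * y 1 ^ 2 + d * y 1 ^ 3 := by
  refine ⟨ph F (bv B (sg F ![1,0]) ![1,0]) (rh F ![1,0]),
    ph F (bv B (sg F ![1,0]) ![1,0]) (rh F ![0,1]) + ph F (bv B (sg F ![1,0]) ![0,1]) (rh F ![1,0])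
      + ph F (bv B (sg F ![0,1]) ![1,0]) (rh F ![1,0]),
    ph F (bv B (sg F ![1,0]) ![0,1]) (rh F ![0,1]) + ph F (bv B (sg F ![0,1]) ![0,1]) (rh F ![1,0])
      + ph F (bv B (sg F ![0,1]) ![1,0]) (rh F ![0,1]),
    ph F (bv B (sg F ![0,1]) ![0,1]) (rh F ![0,1]), fun y => ?_⟩
  simp only [ph, bv, sg, rh, Fin.sum_univ_two, Matrix.cons_val_zero, Matrix.cons_val_one]
  ring

theorem dichotomy [Infinite L] (h : Hyp F U B H D H' C) :
    (∀ y, ph F (bv B (sg F y) y) (rh F y) = 0) ∨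
    (∀ y : Fin 2 → L, ∑ p, ∑ q, U p q * (∑ j, F p j * y j) * (∑ i, y i * F i q) = 0) := by
  obtain ⟨a, b, c, d, habcd⟩ := cubic_form F B
  obtain ⟨e, f, g, hefg⟩ : ∃ e f g : L, ∀ y : Fin 2 → L,
      ∑ p, ∑ q, U p q * (∑ j, F p j * y j) * (∑ i, y i * F i q)
      = e * y 0 ^ 2 + f * y 0 * y 1 + g * y 1 ^ 2 := by
    refine ⟨∑ p, ∑ q, U p q * F p 0 * F 0 q, ∑ p, ∑ q, U p q * (F p 0 * F 1 q + F p 1 * F 0 q),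
      ∑ p, ∑ q, U p q * F p 1 * F 1 q, fun y => ?_⟩
    simp only [Fin.sum_univ_two]
    ring
  have := forms a b c d e f g (fun s => by
    have := lamQ h ![s, 1]
    rw [habcd, hefg] at this
    simpa using this)
  rcases this with ⟨rfl, rfl, rfl, rfl⟩ | ⟨rfl, rfl, rfl⟩
  · left; intro y; rw [habcd]; ring
  · right; intro y; rw [hefg]; ring

theorem unip {W : Type*} [AddCommGroup W] [Module L W] (h2 : (2 : L) ≠ 0) (S : W →ₗ[L] W →ₗ[L] W)
    (n : W →ₗ[L] W) (hn : ∀ w, n (n w) = 0) (k : L) (hk : k ≠ 0)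
    (hS : ∀ y, S (k • y + n y) (k • y + n y) = -(k • (k • S y y + n (S y y)) + n (k • S y y + n (S y y))))
    (y : W) : S y y = 0 := by
  have sc : ∀ (a : L) (w : W), a ≠ 0 → a • w = 0 → w = 0 := fun a w ha hw =>
    (smul_eq_zero.mp hw).resolve_left ha
  have van : ∀ w : W, k • w + n w = 0 → w = 0 := by
    intro w hw
    have h1 := congrArg n hw
    simp only [map_add, map_smul, hn, map_zero, add_zero] at h1
    have h3 : n w = 0 := (smul_eq_zero.mp h1).resolve_left hk
    rw [h3, add_zero] at hw
    exact (smul_eq_zero.mp hw).resolve_left hk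
  have a1 : ∀ y, S (n y) (n y) = 0 := by
    intro y
    have := hS (n y)
    simp only [hn, map_smul, LinearMap.smul_apply, add_zero, map_add] at this
    apply van
    have e : (2 * k) • (k • S (n y) (n y) + n (S (n y) (n y))) = 0 := by
      linear_combination (norm := module) this
    exact (smul_eq_zero.mp e).resolve_left (mul_ne_zero h2 hk)
  have a2 : ∀ y, (2 * k) • S y y + (S y (n y) + S (n y) y) + (2 : L) • n (S y y) = 0 := by
    intro y
    have := hS y
    simp only [hn, map_smul, LinearMap.smul_apply, LinearMap.add_apply, map_add, a1, add_zero] at this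
    apply sc k _ hk
    linear_combination (norm := module) this
  have a3 : ∀ y, S y (n y) + S (n y) y = 0 := by
    intro y
    apply van
    have e1 := a2 y
    have e2 := a2 (y + n y)
    simp only [hn, LinearMap.add_apply, map_add, a1, add_zero] at e2
    apply sc (2 : L) _ h2
    simp only [map_add]
    linear_combination (norm := module) e2 - e1
  apply van
  apply sc (2 : L) _ h2
  linear_combination (norm := module) a2 y - a3 y

theorem last (h : Hyp F U B H D H' C) (h2 : (2 : L) ≠ 0)
    (hd : F 0 0 * F 1 1 - F 0 1 * F 1 0 ≠ 0)
    (ht : (∑ a, ∑ b, U a b * F a b) = 2)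
    (hQ : ∀ y : Fin 2 → L, ∑ p, ∑ q, U p q * (∑ j, F p j * y j) * (∑ i, y i * F i q) = 0) : B = 0 := by
  apply fin_gamma h hd (ht ▸ h2)
  have q0 := hQ ![1,0]
  have q1 := hQ ![0,1]
  have q2 := hQ ![1,1]
  have hab := ab_one h hd ht h2 0 0
  simp [Fin.sum_univ_two, dl] at q0 q1 q2 hab ht
  set d := F 0 0 * F 1 1 - F 0 1 * F 1 0 with hdd
  obtain ⟨g, hg⟩ : ∃ g, g = U 0 0 * F 0 1 * F 0 0 + U 0 1 * F 0 1 * F 0 1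
    + U 1 0 * F 1 1 * F 0 0 + U 1 1 * F 1 1 * F 0 1 := ⟨_, rfl⟩
  have q3 : U 0 0 * F 0 0 * F 1 0 + U 0 1 * F 0 0 * F 1 1
    + U 1 0 * F 1 0 * F 1 0 + U 1 1 * F 1 0 * F 1 1 = -g := by
    rw [hg]; linear_combination q2 - q0 - q1
  have m2 : (F 0 1 - F 1 0)^2 = 4 * d := by
    have hg' := hg.symm
    have u00 : U 0 0 = g * (F 1 1 * (F 0 1 - F 1 0)) / d ^ 2 := by
      rw [eq_div_iff (pow_ne_zero 2 hd), hdd]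
      linear_combination F 1 1 * F 1 1 * q0 - F 1 1 * F 1 0 * hg' - F 0 1 * F 1 1 * q3
        + F 0 1 * F 1 0 * q1
    have u01 : U 0 1 = g * (F 1 0 ^ 2 - F 0 0 * F 1 1) / d ^ 2 := by
      rw [eq_div_iff (pow_ne_zero 2 hd), hdd]
      linear_combination -F 1 0 * F 1 1 * q0 + F 1 0 * F 1 0 * hg' + F 0 0 * F 1 1 * q3
        - F 0 0 * F 1 0 * q1
    have u10 : U 1 0 = g * (F 0 0 * F 1 1 - F 0 1 ^ 2) / d ^ 2 := by
      rw [eq_div_iff (pow_ne_zero 2 hd), hdd]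
      linear_combination -F 1 1 * F 0 1 * q0 + F 1 1 * F 0 0 * hg' + F 0 1 * F 0 1 * q3
        - F 0 1 * F 0 0 * q1
    have u11 : U 1 1 = g * (F 0 0 * (F 0 1 - F 1 0)) / d ^ 2 := by
      rw [eq_div_iff (pow_ne_zero 2 hd), hdd]
      linear_combination F 1 0 * F 0 1 * q0 - F 1 0 * F 0 0 * hg' - F 0 0 * F 0 1 * q3
        + F 0 0 * F 0 0 * q1
    rw [u00, u01, u10, u11] at hab ht
    field_simp at hab ht
    have gd : g ^ 2 = d := by
      apply mul_left_cancel₀ (pow_ne_zero 3 hd)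
      rw [hdd] at hab ⊢
      linear_combination hab
    have gm : g * (F 1 0 - F 0 1) = -2 * d := by
      apply mul_left_cancel₀ hd
      rw [hdd] at ht ⊢
      linear_combination -ht
    apply mul_left_cancel₀ hd
    linear_combination (g * (F 1 0 - F 0 1) - 2 * d) * gm - (F 0 1 - F 1 0)^2 * gd
  have rel : ∀ y i, ∑ p, F p i * bv B (sg F y) y p + ∑ q, F i q * bv B y (rh F y) q = 0 := by
    intro y
    have s1 := fun p q => star1 h y p q
    set l := ph F (bv B (sg F y) y) (rh F y) with hl
    have a := s1 0 0
    have b := s1 0 1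
    have c := s1 1 0
    have e := s1 1 1
    by_cases hy : y = 0
    · intro i; simp [hy, bv, Fin.sum_univ_two]
    generalize bv B (sg F y) y = G at *
    generalize bv B y (rh F y) = G' at *
    clear_value l
    simp only [sg, rh, Fin.sum_univ_two, Matrix.cons_val_zero, Matrix.cons_val_one] at a b c e ⊢
    have r0 : d * y 1 * (F 0 0 * G 0 + F 1 0 * G 1 + (F 0 0 * G' 0 + F 0 1 * G' 1)) = 0 := by
      rw [hdd]
      linear_combination F 0 0 * F 0 0 * a + F 0 0 * F 0 1 * b + F 1 0 * F 0 0 * c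
        + F 1 0 * F 0 1 * e + l * q0
    have r1 : d * y 0 * (F 0 1 * G 0 + F 1 1 * G 1 + (F 1 0 * G' 0 + F 1 1 * G' 1)) = 0 := by
      rw [hdd]
      linear_combination -F 0 1 * F 1 0 * a - F 0 1 * F 1 1 * b - F 1 1 * F 1 0 * c
        - F 1 1 * F 1 1 * e - l * q1
    have r2 : d * y 0 * (F 0 0 * G 0 + F 1 0 * G 1 + (F 0 0 * G' 0 + F 0 1 * G' 1)) =
      d * y 1 * (F 0 1 * G 0 + F 1 1 * G 1 + (F 1 0 * G' 0 + F 1 1 * G' 1)) := by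
      rw [hdd]
      linear_combination -(F 0 0 * F 1 0 + F 0 1 * F 0 0) * a - (F 0 0 * F 1 1 + F 0 1 * F 0 1) * b
        - (F 1 0 * F 1 0 + F 1 1 * F 0 0) * c
        - (F 1 0 * F 1 1 + F 1 1 * F 0 1) * e - l * (q2 - q0 - q1)
    have hy' : y 0 ≠ 0 ∨ y 1 ≠ 0 := by
      by_contra hc
      push Not at hc
      apply hy; funext i; fin_cases i
      · exact hc.1
      · exact hc.2
    generalize hX : F 0 0 * G 0 + F 1 0 * G 1 + (F 0 0 * G' 0 + F 0 1 * G' 1) = X at *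
    generalize hX' : F 0 1 * G 0 + F 1 1 * G 1 + (F 1 0 * G' 0 + F 1 1 * G' 1) = X' at *
    have : X = 0 ∧ X' = 0 := by
      rcases hy' with hy' | hy'
      · have : X' = 0 := (mul_eq_zero.mp r1).resolve_left (mul_ne_zero hd hy')
        rw [this, mul_zero] at r2
        exact ⟨(mul_eq_zero.mp r2).resolve_left (mul_ne_zero hd hy'), this⟩
      · have : X = 0 := (mul_eq_zero.mp r0).resolve_left (mul_ne_zero hd hy')
        rw [this, mul_zero] at r2
        exact ⟨this, (mul_eq_zero.mp r2.symm).resolve_left (mul_ne_zero hd hy')⟩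
    rw [Fin.forall_fin_two]
    refine ⟨?_, ?_⟩
    · rw [← this.1, hX]
    · rw [← this.2, hX']
  have gr : ∀ y i, bv B (sg F (rh F y)) (rh F y) i = - rh F (rh F (bv B (sg F y) y)) i := by
    intro y i
    have sr : ∀ i, sg F (rh F y) i = -d * y i := by
      intro i
      fin_cases i <;> simp [rh, sg, hdd] <;> ring
    rw [bv_ext B i (-d) 1 (x' := y) (y' := rh F y) sr (by simp)]
    have r0 := rel y 0
    have r1 := rel y 1
    generalize bv B (sg F y) y = G at *
    generalize bv B y (rh F y) = G' at *
    simp only [Fin.sum_univ_two] at r0 r1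
    fin_cases i
    · simp [rh, hdd]
      linear_combination -F 1 1 * r0 + F 0 1 * r1
    · simp [rh, hdd]
      linear_combination F 1 0 * r0 - F 0 0 * r1
  let k : L := (F 0 1 - F 1 0) / 2
  have hkk : k * 2 = F 0 1 - F 1 0 := by simp only [k]; field_simp
  have hk2 : k ^ 2 = d := by
    apply mul_left_cancel₀ (mul_ne_zero h2 h2)
    linear_combination m2 + (k * 2 + (F 0 1 - F 1 0)) * hkk
  have hk0 : k ≠ 0 := by
    intro hk; apply hd; rw [← hk2, hk]; ring
  clear_value k
  let S : (Fin 2 → L) →ₗ[L] (Fin 2 → L) →ₗ[L] (Fin 2 → L) :=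
    LinearMap.mk₂ L (fun x y => bv B (sg F x) y)
      (by intro a b c; funext i; simp [bv, sg, Fin.sum_univ_two]; ring)
      (by intro a b c; funext i; simp [bv, sg, Fin.sum_univ_two]; ring)
      (by intro a b c; funext i; simp [bv, sg, Fin.sum_univ_two]; ring)
      (by intro a b c; funext i; simp [bv, sg, Fin.sum_univ_two]; ring)
  let R : (Fin 2 → L) →ₗ[L] (Fin 2 → L) :=
    { toFun := rh F
      map_add' := by intro a b; funext i; fin_cases i <;> simp [rh] <;> ring
      map_smul' := by intro a b; funext i; fin_cases i <;> simp [rh] <;> ring }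
  let n : (Fin 2 → L) →ₗ[L] (Fin 2 → L) := R - k • LinearMap.id
  have hR : ∀ y, k • y + n y = R y := by
    intro y; simp [n]
  have := unip h2 S n (by
      intro w
      funext i
      fin_cases i
      · simp [n, R, rh, Matrix.vecHead, Matrix.vecTail]
        rw [hdd] at hk2
        linear_combination (w 0) * hk2 - (F 0 1 * w 0 + F 1 1 * w 1) * hkk
      · simp [n, R, rh, Matrix.vecHead, Matrix.vecTail]
        rw [hdd] at hk2
        linear_combination (w 1) * hk2 + (F 0 0 * w 0 + F 1 0 * w 1) * hkk) k hk0 (by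
      intro y
      rw [hR, hR, hR]
      funext i
      exact gr y i)
  intro y i
  exact congrFun (this y) i

theorem all_zero [Infinite L] (h : Hyp F U B H D H' C) (h2 : (2 : L) ≠ 0)
    (ht : (∑ a, ∑ b, U a b * F a b) ≠ 0 ∨ F = 0) : B = 0 := by
  by_cases hd : F 0 0 * F 1 1 - F 0 1 * F 1 0 = 0
  · exact degen h hd
  rcases ht with ht | rfl
  · by_cases ht2 : (∑ a, ∑ b, U a b * F a b) = 2
    · rcases dichotomy h with hl | hQ
      · exact lam_zero h h2 hd ht hl
      · exact last h h2 hd ht2 hQ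
    · exact t_ne_two h h2 hd ht ht2
  · simp at hd

theorem all_zero' (h : Hyp F U B H D H' C) (h2 : (2 : L) ≠ 0)
    (ht : (∑ a, ∑ b, U a b * F a b) ≠ 0 ∨ F = 0) : B = 0 := by
  let f := algebraMap L (AlgebraicClosure L)
  have hf : Function.Injective f := (algebraMap L (AlgebraicClosure L)).injective
  have hdl : ∀ i j, f (dl i j) = dl i j := by
    intro i j; simp only [dl]; split_ifs <;> simp
  have : Hyp (fun i j => f (F i j)) (fun i j => f (U i j)) (fun i j k => f (B i j k))
      (fun i j k => f (H i j k)) (fun i j k => f (D i j k)) (fun i j k => f (H' i j k))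
      (fun i j k => f (C i j k)) := by
    constructor
    · intro k; simpa only [map_sum, map_mul, map_zero] using congrArg f (h.bu k)
    · intro i j k p q
      simpa only [map_sum, map_mul, map_add, map_sub, hdl] using congrArg f (h.b1 i j k p q)
    · intro i j k p q
      simpa only [map_sum, map_mul, map_add, map_sub, hdl] using congrArg f (h.b2 i j k p q)
    · intro i j k p q r
      simpa only [map_sum, map_mul, map_add, map_sub, map_one, hdl] using congrArg f (h.yb i j k p q r)
  have h0 := all_zero this (by
      have := (map_ne_zero_iff f hf).mpr h2
      rwa [map_ofNat] at this) (by
      rcases ht with ht | rfl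
      · left
        have := (map_ne_zero_iff f hf).mpr ht
        simpa only [map_sum, map_mul] using this
      · right; funext i j; simp)
  funext i j k
  apply hf
  have := congrFun (congrFun (congrFun h0 i) j) k
  simpa using this

end QL

namespace QL

theorem translate (c : (V ⊗[K] V) →ₗ[K] (V ⊗[K] V)) (β : (V ⊗[K] V) →ₗ[K] V)
    (hQ : IsLiftedQLie K V c β) (e : Module.Basis (Fin 2) K V)
    (u : V ⊗[K] V) (φ : (V ⊗[K] V) →ₗ[K] K) (hc : ∀ w, c w = -w + φ w • u) (hβu : β u = 0)
    (ht : φ u ≠ 0 ∨ φ = 0) (h2 : (2 : K) ≠ 0) : β = 0 := by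
  obtain ⟨hyb, hb1, hb2, -, -⟩ := hQ
  let ee := e.tensorProduct e
  let eee := e.tensorProduct ee
  let U : Fin 2 → Fin 2 → K := fun i j => ee.repr u (i, j)
  let F : Fin 2 → Fin 2 → K := fun i j => φ (e i ⊗ₜ e j)
  let B : Fin 2 → Fin 2 → Fin 2 → K := fun i j k => e.repr (β (e i ⊗ₜ e j)) k
  have hu : u = ∑ i, ∑ j, U i j • (e i ⊗ₜ[K] e j) := by
    rw [← Fintype.sum_prod_type']
    conv_lhs => rw [← ee.sum_repr u]
    apply Finset.sum_congr rfl
    rintro ⟨i, j⟩ _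
    simp [U, ee, Module.Basis.tensorProduct_apply]
  have hB : ∀ i j, β (e i ⊗ₜ e j) = ∑ k, B i j k • e k := by
    intro i j
    exact (e.sum_repr _).symm
  have hφu : φ u = ∑ a, ∑ b, U a b * F a b := by
    conv_lhs => rw [hu]
    simp only [map_sum, map_smul, smul_eq_mul, F]
  let P : V →ₗ[K] V ⊗[K] (V ⊗[K] V) :=
    (TensorProduct.assoc K V V V).toLinearMap ∘ₗ (TensorProduct.mk K (V ⊗[K] V) V u)
  let R : V →ₗ[K] V ⊗[K] (V ⊗[K] V) := (TensorProduct.mk K V (V ⊗[K] V)).flip u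
  have hP : ∀ z, P z = ∑ i, ∑ j, U i j • (e i ⊗ₜ[K] (e j ⊗ₜ[K] z)) := by
    intro z
    simp only [P, LinearMap.comp_apply, TensorProduct.mk_apply]
    conv_lhs => rw [hu]
    simp only [TensorProduct.sum_tmul, map_sum, ← TensorProduct.smul_tmul', map_smul, LinearEquiv.coe_coe,
      TensorProduct.assoc_tmul]
  have hR : ∀ z, R z = ∑ i, ∑ j, U i j • (z ⊗ₜ[K] (e i ⊗ₜ[K] e j)) := by
    intro z
    simp only [R, LinearMap.flip_apply, TensorProduct.mk_apply]
    conv_lhs => rw [hu]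
    simp only [TensorProduct.tmul_sum, TensorProduct.tmul_smul]
  let A : V → V := fun x => ∑ m, ∑ n, (U m n * φ (x ⊗ₜ e m)) • e n
  let Bo : V → V := fun z => ∑ m, ∑ n, (U m n * φ (e n ⊗ₜ z)) • e m
  have c1 : ∀ x y z, cOne K V c (x ⊗ₜ (y ⊗ₜ z)) = - x ⊗ₜ (y ⊗ₜ z) + φ (x ⊗ₜ y) • P z := by
    intro x y z
    simp [cOne, hc, P, TensorProduct.add_tmul, TensorProduct.neg_tmul]
    rw [← TensorProduct.smul_tmul', map_smul]
  have c2 : ∀ x y z, cTwo K V c (x ⊗ₜ (y ⊗ₜ z)) = - x ⊗ₜ (y ⊗ₜ z) + φ (y ⊗ₜ z) • R x := by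
    intro x y z
    simp [cTwo, hc, R, TensorProduct.tmul_add, TensorProduct.tmul_neg, TensorProduct.neg_tmul]
  have b1 : ∀ x y z, betaOne K V β (x ⊗ₜ (y ⊗ₜ z)) = β (x ⊗ₜ y) ⊗ₜ z := by
    intro x y z; simp [betaOne]
  have b2 : ∀ x y z, betaTwo K V β (x ⊗ₜ (y ⊗ₜ z)) = x ⊗ₜ β (y ⊗ₜ z) := by
    intro x y z; simp [betaTwo]
  have c1P : ∀ z, cOne K V c (P z) = - P z + φ u • P z := by
    intro z
    simp [cOne, hc, P, TensorProduct.add_tmul, TensorProduct.neg_tmul]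
    rw [← TensorProduct.smul_tmul', map_smul]
  have c2R : ∀ z, cTwo K V c (R z) = - R z + φ u • R z := by
    intro z
    simp [cTwo, hc, R, TensorProduct.tmul_add, TensorProduct.tmul_neg]
  have b1P : ∀ z, betaOne K V β (P z) = 0 := by
    intro z; simp [betaOne, P, hβu]
  have b2R : ∀ z, betaTwo K V β (R z) = 0 := by
    intro z; simp [betaTwo, R, hβu]
  have c2P : ∀ z, cTwo K V c (P z) = - P z + R (Bo z) := by
    intro z
    rw [hP]
    simp only [map_sum, map_smul, c2, Bo, smul_add, Finset.sum_add_distrib, TensorProduct.neg_tmul,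
      smul_neg, Finset.sum_neg_distrib, smul_smul]
  have c1R : ∀ z, cOne K V c (R z) = - R z + P (A z) := by
    intro z
    rw [hR]
    simp only [map_sum, map_smul, c1, A, smul_add, Finset.sum_add_distrib, TensorProduct.neg_tmul,
      smul_neg, Finset.sum_neg_distrib, smul_smul]
  have YB : ∀ x y z, φ (x ⊗ₜ y) • (P (A (Bo z)) - (φ u - 1) • P z)
      = φ (y ⊗ₜ z) • (R (Bo (A x)) - (φ u - 1) • R x) := by
    intro x y z
    have := LinearMap.congr_fun hyb (x ⊗ₜ (y ⊗ₜ z))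
    simp only [LinearMap.comp_apply, c1, c2, map_add, map_neg, map_smul, c1P, c2R, c2P, c1R,
      TensorProduct.neg_tmul] at this
    linear_combination (norm := module) this
  have E1 : ∀ x y z, β (x ⊗ₜ y) ⊗ₜ z + x ⊗ₜ β (y ⊗ₜ z) = φ (β (x ⊗ₜ y) ⊗ₜ z) • u
      - φ (y ⊗ₜ z) • betaTwo K V β (P (A x)) + φ (x ⊗ₜ y) • betaTwo K V β (P z) := by
    intro x y z
    have := LinearMap.congr_fun hb1 (x ⊗ₜ (y ⊗ₜ z))
    simp only [LinearMap.comp_apply, c1, c2, map_add, map_neg, map_smul, c1P, c2R, c2P, c1R, b1, b2,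
      b1P, b2R, TensorProduct.neg_tmul, hc] at this
    linear_combination (norm := module) -this
  have E2 : ∀ x y z, β (x ⊗ₜ y) ⊗ₜ z + x ⊗ₜ β (y ⊗ₜ z) = φ (x ⊗ₜ β (y ⊗ₜ z)) • u
      - φ (x ⊗ₜ y) • betaOne K V β (R (Bo z)) + φ (y ⊗ₜ z) • betaOne K V β (R x) := by
    intro x y z
    have := LinearMap.congr_fun hb2 (x ⊗ₜ (y ⊗ₜ z))
    simp only [LinearMap.comp_apply, c1, c2, map_add, map_neg, map_smul, c1P, c2R, c2P, c1R, b1, b2,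
      b1P, b2R, TensorProduct.neg_tmul, hc] at this
    linear_combination (norm := module) -this
  let D : Fin 2 → Fin 2 → Fin 2 → K := fun k p q => ee.repr (betaTwo K V β (P (e k))) (p, q)
  let C : Fin 2 → Fin 2 → Fin 2 → K := fun k p q => ee.repr (betaOne K V β (R (e k))) (p, q)
  have he : ∀ i j, e.repr (e i) j = dl i j := by
    intro i j; simp [dl, Finsupp.single_apply]
  have rP : ∀ z p q r, eee.repr (P z) (p, q, r) = U p q * e.repr z r := by
    intro z p q r
    rw [hP]
    simp only [map_sum, map_smul, Finsupp.coe_finsetSum, Finset.sum_apply, Finsupp.smul_apply, eee, ee,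
      Module.Basis.tensorProduct_repr_tmul_apply, he, smul_eq_mul]
    simp [dl]
  have rR : ∀ z p q r, eee.repr (R z) (p, q, r) = e.repr z p * U q r := by
    intro z p q r
    simp [R, eee, U, Module.Basis.tensorProduct_repr_tmul_apply, mul_comm]
  have hyp : Hyp F U B (fun m p q => ∑ n, U m n * D n p q) D
      (fun n p q => ∑ m, U m n * C m p q) C := by
    constructor
    · intro k
      have : e.repr (β u) k = 0 := by simp [hβu]
      rw [hu] at this
      simpa [map_sum, map_smul, B] using this
    · intro i j k p q
      have := congrArg (fun w => ee.repr w (p, q)) (E1 (e i) (e j) (e k))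
      have h1 : φ (β (e i ⊗ₜ e j) ⊗ₜ e k) = ∑ r, B i j r * F r k := by
        rw [hB]
        simp only [TensorProduct.sum_tmul, map_sum, ← TensorProduct.smul_tmul', map_smul, smul_eq_mul, F]
      simp only [A, h1, map_add, map_sub, map_smul, map_sum, Finsupp.add_apply, Finsupp.sub_apply,
        Finsupp.smul_apply, Finsupp.coe_finsetSum, Finset.sum_apply, smul_eq_mul] at this
      rw [show ee.repr (β (e i ⊗ₜ e j) ⊗ₜ e k) (p, q) = B i j p * dl k q by
          simp only [ee, B, he, mul_comm, smul_eq_mul, Module.Basis.tensorProduct_repr_tmul_apply],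
        show ee.repr (e i ⊗ₜ β (e j ⊗ₜ e k)) (p, q) = dl i p * B j k q by
          simp only [ee, B, he, mul_comm, smul_eq_mul, Module.Basis.tensorProduct_repr_tmul_apply]] at this
      rw [this]
      simp only [Fin.sum_univ_two, U, F, D]
      ring
    · intro i j k p q
      have := congrArg (fun w => ee.repr w (p, q)) (E2 (e i) (e j) (e k))
      have h1 : φ (e i ⊗ₜ β (e j ⊗ₜ e k)) = ∑ r, F i r * B j k r := by
        rw [hB]
        simp only [TensorProduct.tmul_sum, map_sum, TensorProduct.tmul_smul, map_smul, smul_eq_mul, F, mul_comm]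
      simp only [Bo, h1, map_add, map_sub, map_smul, map_sum, Finsupp.add_apply, Finsupp.sub_apply,
        Finsupp.smul_apply, Finsupp.coe_finsetSum, Finset.sum_apply, smul_eq_mul] at this
      rw [show ee.repr (β (e i ⊗ₜ e j) ⊗ₜ e k) (p, q) = B i j p * dl k q by
          simp only [ee, B, he, mul_comm, smul_eq_mul, Module.Basis.tensorProduct_repr_tmul_apply],
        show ee.repr (e i ⊗ₜ β (e j ⊗ₜ e k)) (p, q) = dl i p * B j k q by
          simp only [ee, B, he, mul_comm, smul_eq_mul, Module.Basis.tensorProduct_repr_tmul_apply]] at this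
      rw [this]
      simp only [Fin.sum_univ_two, U, F, C]
      ring
    · intro i j k p q r
      have := congrArg (fun w => eee.repr w (p, q, r)) (YB (e i) (e j) (e k))
      simp only [map_sub, map_smul, Finsupp.sub_apply, Finsupp.smul_apply, smul_eq_mul, rP, rR, hφu, he] at this
      have rA : ∀ x r, e.repr (A x) r = ∑ m, U m r * φ (x ⊗ₜ e m) := by
        intro x r
        simp only [A, map_sum, map_smul, Finsupp.smul_apply, Finsupp.coe_finsetSum, Finset.sum_apply,
          smul_eq_mul, he]
        simp [dl]
      have rB : ∀ z r, e.repr (Bo z) r = ∑ n, U r n * φ (e n ⊗ₜ z) := by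
        intro x r
        simp only [Bo, map_sum, map_smul, Finsupp.smul_apply, Finsupp.coe_finsetSum, Finset.sum_apply,
          smul_eq_mul, he]
        rw [Finset.sum_comm]
        simp [dl]
      have pA : ∀ n i, φ (e n ⊗ₜ A (e i)) = ∑ a, ∑ b, U a b * F i a * F n b := by
        intro n i
        simp only [A, TensorProduct.tmul_sum, TensorProduct.tmul_smul, map_sum, map_smul, smul_eq_mul, F]
      have pB : ∀ k m, φ (Bo (e k) ⊗ₜ e m) = ∑ a, ∑ b, U a b * F b k * F a m := by
        intro k m
        simp only [Bo, TensorProduct.sum_tmul, ← TensorProduct.smul_tmul', map_sum, map_smul, smul_eq_mul, F]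
      simp only [rA, rB, pA, pB] at this
      change F i j * _ = F j k * _ at this
      simp only [Fin.sum_univ_two] at this ⊢
      linear_combination this
  have hB0 := all_zero' hyp h2 (by
    rcases ht with ht | ht
    · left; rwa [← hφu]
    · right; funext i j; simp [F, ht])
  apply ee.ext
  rintro ⟨i, j⟩
  simp [ee, Module.Basis.tensorProduct_apply, hB, hB0]

end QL

/-- If `char K ≠ 2`, `(V, c, β)` is a lifted QLie algebra with `dim_K V = 2`, `β ≠ 0`,
the minimal polynomial of `c` is `(X+1)·h` with `h(−1) ≠ 0`, and `dim_K Im β = 2`,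
then `dim_K Im (c + Id) = 2`. -/
theorem finrank_range_add_id_eq_two
    (hchar : ringChar K ≠ 2)
    (c : (V ⊗[K] V) →ₗ[K] (V ⊗[K] V)) (β : (V ⊗[K] V) →ₗ[K] V)
    (hQ : IsLiftedQLie K V c β)
    (hdim : Module.finrank K V = 2)
    (hβ : β ≠ 0)
    (h : Polynomial K)
    (hmin : minpoly K c = (Polynomial.X + 1) * h)
    (hh : Polynomial.eval (-1 : K) h ≠ 0)
    (him : Module.finrank K (LinearMap.range β) = 2) :
    Module.finrank K
      (LinearMap.range (c + (LinearMap.id : (V ⊗[K] V) →ₗ[K] (V ⊗[K] V)))) = 2 := by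
  have h2 : (2 : K) ≠ 0 := Ring.two_ne_zero hchar
  haveI : FiniteDimensional K V := FiniteDimensional.of_finrank_pos (by omega)
  let e := Module.finBasisOfFinrankEq K V hdim
  have hA := hQ.2.2.2.2
  have hAw : ∀ w, β (c w) = - β w := fun w => LinearMap.congr_fun hA w
  have hle : LinearMap.range (c + LinearMap.id) ≤ LinearMap.ker β := by
    rintro _ ⟨w, rfl⟩
    simp [hAw]
  have hker : Module.finrank K (LinearMap.ker β) = 2 := by
    have := LinearMap.finrank_range_add_finrank_ker β
    rw [him, Module.finrank_tensorProduct, hdim] at this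
    omega
  have hle2 := Submodule.finrank_mono hle
  rw [hker] at hle2
  by_contra hne
  have hle1 : Module.finrank K (LinearMap.range (c + (LinearMap.id : (V ⊗[K] V) →ₗ[K] (V ⊗[K] V)))) ≤ 1 := by
    omega
  apply hβ
  have zero_case : (∀ w, c w = -w) → β = 0 := fun hz =>
    QL.translate K V c β hQ e 0 0 (by simpa using hz) (by simp) (Or.inr rfl) h2
  obtain ⟨⟨u, hu⟩, hspan⟩ := finrank_le_one_iff.1 hle1
  have hspan' : ∀ w, ∃ a : K, a • u = c w + w := by
    intro w
    obtain ⟨a, ha⟩ := hspan ⟨c w + w, w, by simp⟩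
    exact ⟨a, congrArg Subtype.val ha⟩
  by_cases hu0 : u = 0
  · apply zero_case
    intro w
    obtain ⟨a, ha⟩ := hspan' w
    rw [hu0, smul_zero] at ha
    exact eq_neg_of_add_eq_zero_left ha.symm
  obtain ⟨g, hg⟩ := Module.Projective.exists_dual_eq_one K hu0
  let φ : (V ⊗[K] V) →ₗ[K] K := g ∘ₗ (c + LinearMap.id)
  have hφ : ∀ w, c w + w = φ w • u := by
    intro w
    obtain ⟨a, ha⟩ := hspan' w
    have : φ w = a := by
      simp only [φ, LinearMap.comp_apply, LinearMap.add_apply, LinearMap.id_apply, ← ha, map_smul, hg]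
      simp
    rw [this, ha]
  have hc : ∀ w, c w = -w + φ w • u := by
    intro w; rw [← hφ]; abel
  by_cases ht : φ u = 0
  · apply zero_case
    have hsq : aeval c ((X + 1 : K[X]) ^ 2) = 0 := by
      refine LinearMap.ext fun w => ?_
      have h1 : c u + u = 0 := by rw [hφ, ht, zero_smul]
      simp only [pow_two, map_mul, map_add, aeval_X, map_one]
      change c (c w + w) + (c w + w) = 0
      rw [hφ w, map_smul, ← smul_add, h1, smul_zero]
    have hdvd := minpoly.dvd K c hsq
    rw [hmin, pow_two] at hdvd
    have hX : (X + 1 : K[X]) ≠ 0 := by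
      have := Polynomial.X_add_C_ne_zero (1 : K)
      simpa using this
    have hd : h ∣ X + 1 := (mul_dvd_mul_iff_left hX).1 hdvd
    have hX1 : (X + 1 : K[X]) = X - C (-1) := by simp
    have hcop : IsCoprime (X + 1 : K[X]) h := by
      rw [hX1]
      refine ((Polynomial.irreducible_X_sub_C (-1 : K)).coprime_iff_not_dvd).2 ?_
      rw [Polynomial.dvd_iff_isRoot]
      exact hh
    have hunit : IsUnit h := hcop.isUnit_of_dvd' hd dvd_rfl
    obtain ⟨k, hk⟩ := hunit.exists_right_inv
    have h0 := minpoly.aeval K c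
    have h3 : aeval c (X + 1 : K[X]) = 0 := by
      have : (X + 1 : K[X]) = minpoly K c * k := by rw [hmin, mul_assoc, hk, mul_one]
      rw [this, map_mul, h0, zero_mul]
    intro w
    have := LinearMap.congr_fun h3 w
    simp only [map_add, aeval_X, map_one] at this
    exact eq_neg_of_add_eq_zero_left this
  · refine QL.translate K V c β hQ e u φ hc ?_ (Or.inl ht) h2
    have := hAw u
    rw [hc, map_add, map_neg, map_smul] at this
    have h5 : φ u • β u = 0 := by simpa using this
    exact (smul_eq_zero.1 h5).resolve_left ht

end
end

section
/- Let K be a field with char K ≠ 2 and let (V, c, β) be a lifted QLie algebra over K with dim_K V = 2. Assume the minimal polynomial of c, regarded as an endomorphism of V ⊗ V, is f = (X+1)·h with h ∈ K[X] and h(−1) ≠ 0. Assume moreover that β is surjective (dim_K Im β = 2) and that dim_K Im(c + Id_{V⊗V}) = 1. Then ker β is the internal direct sum of Im(c + Id_{V⊗V}) and ker β ∩ Im(h(c)); in particular Im(c + Id_{V⊗V}) ⊆ ker β. -/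
open TensorProduct Polynomial

noncomputable section

variable (K V : Type*) [Field K] [AddCommGroup V] [Module K V]

/-- If `char K ≠ 2`, `(V, c, β)` is a lifted QLie algebra with `dim_K V = 2`, the minimal
polynomial of `c` is `(X+1)·h` with `h(−1) ≠ 0`, `β` is surjective and
`dim_K Im (c + Id) = 1`, then `ker β` is the internal direct sum of `Im (c + Id)` and
`ker β ⊓ Im (h(c))`; in particular `Im (c + Id) ⊆ ker β`. -/
theorem ker_beta_decomposition
    (hchar : ringChar K ≠ 2)
    (c : (V ⊗[K] V) →ₗ[K] (V ⊗[K] V)) (β : (V ⊗[K] V) →ₗ[K] V)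
    (hQ : IsLiftedQLie K V c β)
    (hdim : Module.finrank K V = 2)
    (h : Polynomial K)
    (hmin : minpoly K c = (Polynomial.X + 1) * h)
    (hh : Polynomial.eval (-1 : K) h ≠ 0)
    (hsurj : Function.Surjective β)
    (hone : Module.finrank K
      (LinearMap.range (c + (LinearMap.id : (V ⊗[K] V) →ₗ[K] (V ⊗[K] V)))) = 1) :
    LinearMap.range (c + (LinearMap.id : (V ⊗[K] V) →ₗ[K] (V ⊗[K] V))) ⊔
        (LinearMap.ker β ⊓ LinearMap.range (Polynomial.aeval c h)) = LinearMap.ker β ∧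
    LinearMap.range (c + (LinearMap.id : (V ⊗[K] V) →ₗ[K] (V ⊗[K] V))) ⊓
        (LinearMap.ker β ⊓ LinearMap.range (Polynomial.aeval c h)) = ⊥ ∧
    LinearMap.range (c + (LinearMap.id : (V ⊗[K] V) →ₗ[K] (V ⊗[K] V))) ≤
      LinearMap.ker β := by
  have hA : ∀ x, β (c x) = -β x := fun x => by
    have := LinearMap.congr_fun hQ.2.2.2.2 x
    simpa using this
  have hle : LinearMap.range (c + (LinearMap.id : (V ⊗[K] V) →ₗ[K] (V ⊗[K] V))) ≤
      LinearMap.ker β := by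
    rintro _ ⟨y, rfl⟩
    simp [hA]
  have hX : Polynomial.aeval c (Polynomial.X + 1 : Polynomial K)
      = c + (LinearMap.id : (V ⊗[K] V) →ₗ[K] (V ⊗[K] V)) := by
    simp
    rfl
  have hcop : IsCoprime (Polynomial.X + 1 : Polynomial K) h := by
    have e : (Polynomial.X + 1 : Polynomial K) = Polynomial.X - Polynomial.C (-1) := by simp
    rw [e, (Polynomial.irreducible_X_sub_C (-1 : K)).coprime_iff_not_dvd,
      Polynomial.dvd_iff_isRoot]
    exact hh
  obtain ⟨u, v, huv⟩ := hcop
  have hz : Polynomial.aeval c ((Polynomial.X + 1) * h) = 0 := by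
    rw [← hmin]; exact minpoly.aeval K c
  have hdec : ∀ x, Polynomial.aeval c (u * (Polynomial.X + 1)) x
      + Polynomial.aeval c (v * h) x = x := fun x => by
    rw [← LinearMap.add_apply, ← map_add, huv]; simp
  refine ⟨le_antisymm (sup_le hle inf_le_left) ?_, ?_, hle⟩
  · intro x hx
    have h1 : Polynomial.aeval c (u * (Polynomial.X + 1)) x ∈
        LinearMap.range (c + (LinearMap.id : (V ⊗[K] V) →ₗ[K] (V ⊗[K] V))) := by
      rw [mul_comm, map_mul, hX]
      exact ⟨_, rfl⟩
    refine Submodule.mem_sup.2 ⟨_, h1, _, ⟨?_, ?_⟩, hdec x⟩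
    · rw [eq_sub_iff_add_eq'.2 (hdec x)]
      exact Submodule.sub_mem _ hx (hle h1)
    · rw [mul_comm, map_mul]
      exact ⟨_, rfl⟩
  · rw [eq_bot_iff]
    rintro x ⟨⟨y, hy⟩, -, ⟨z, hz'⟩⟩
    rw [Submodule.mem_bot, ← hdec x]
    have e1 : Polynomial.aeval c (u * (Polynomial.X + 1)) x = 0 := by
      rw [← hz', ← Module.End.mul_apply, ← map_mul, mul_assoc, map_mul, hz]; simp
    have e2 : Polynomial.aeval c (v * h) x = 0 := by
      rw [← hy, ← hX, ← Module.End.mul_apply, ← map_mul, mul_assoc, mul_comm h, map_mul, hz]; simp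
    rw [e1, e2, add_zero]

end
end

section
/- Let K be a field with char K ≠ 2, V a K-vector space, and β : V ⊗ V → V a K-linear map such that β ⊗ id_V = −(id_V ⊗ β) as maps V ⊗ V ⊗ V → V ⊗ V. Then β = 0. (Equivalently: if c = −Id_{V⊗V} and c ∘ (β ⊗ id_V) = (id_V ⊗ β) ∘ c₁ ∘ c₂, then β = 0.) -/
open TensorProduct Polynomial

noncomputable section

variable (K V : Type*) [Field K] [AddCommGroup V] [Module K V]

/-- If `char K ≠ 2` and `β ⊗ id = −(id ⊗ β)` as maps `V ⊗ V ⊗ V → V ⊗ V`,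
then `β = 0`. -/
theorem beta_eq_zero_of_betaOne_eq_neg_betaTwo
    (hchar : ringChar K ≠ 2)
    (β : (V ⊗[K] V) →ₗ[K] V)
    (h : betaOne K V β = - betaTwo K V β) :
    β = 0 := by
  have h2 : (2 : K) ≠ 0 := Ring.two_ne_zero hchar
  have key : ∀ (f : Module.Dual K V) (x y z : V),
      f z • β (x ⊗ₜ[K] y) = - (f (β (y ⊗ₜ[K] z)) • x) := by
    intro f x y z
    have h1 := congrArg (TensorProduct.rid K V)
      (congrArg (LinearMap.lTensor V f) (LinearMap.congr_fun h (x ⊗ₜ[K] (y ⊗ₜ[K] z))))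
    simpa [betaOne, betaTwo] using h1
  apply TensorProduct.ext'
  intro y x
  rw [LinearMap.zero_apply]
  by_cases hx : x = 0
  · simp [hx]
  obtain ⟨f, hf⟩ : ∃ f : Module.Dual K V, f x ≠ 0 := by
    by_contra hcon
    push Not at hcon
    exact hx ((Module.forall_dual_apply_eq_zero_iff K x).1 hcon)
  have h3 : f (β (x ⊗ₜ[K] x)) = 0 := by
    have h4 := congrArg f (key f x x x)
    simp only [map_smul, map_neg, smul_eq_mul] at h4
    have h5 : (2 : K) * f x * f (β (x ⊗ₜ[K] x)) = 0 := by linear_combination h4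
    exact (mul_eq_zero.1 h5).resolve_left (mul_ne_zero h2 hf)
  have h6 := key f y x x
  rw [h3, zero_smul, neg_zero] at h6
  exact (smul_eq_zero.1 h6).resolve_left hf

end
end
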